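/- Let (M, D) be an Engel structure with D trivial as a bundle and M orientable. The following are equivalent: (1) the characteristic foliation W is volume preserving; (2) there exist Engel defining forms α, β such that L_R D ⊂ D (the flow of the Reeb vector field R preserves D); (3) there exist Engel defining forms α, β such that ker dα = ⟨W, R⟩; (4) there exist Engel defining forms α, β such that β ∧ dα = 0; (5) there exists a defining form α for E such that the conformal class of β = L_X α does not depend on the choice of section X of D transverse to W. Moreover, if dα ∧ dα = 0, then there is a choice β = −L_X α such that all the above properties are verified simultaneously. -/

import Mathlib

noncomputable section

open Manifold Module Function Set

variable {E : Type*} [NormedAddCommGroup E] [NormedSpace ℝ E]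
  {H : Type*} [TopologicalSpace H]

/-- The type of (not necessarily smooth) vector fields on a manifold. -/
abbrev VF (I : ModelWithCorners ℝ E H) (M : Type*) [TopologicalSpace M] [ChartedSpace H M] :=
  ∀ x : M, TangentSpace I x

/-- A vector field is smooth if the corresponding section of the tangent bundle is smooth. -/
def SmoothVF (I : ModelWithCorners ℝ E H) {M : Type*} [TopologicalSpace M] [ChartedSpace H M]
    [IsManifold I (⊤ : ℕ∞) M] (V : VF I M) : Prop :=
  ContMDiff I I.tangent (⊤ : ℕ∞) (fun x => (⟨x, V x⟩ : TangentBundle I M))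

/-- A smooth real valued function on a manifold. -/
def SmoothFn (I : ModelWithCorners ℝ E H) {M : Type*} [TopologicalSpace M] [ChartedSpace H M]
    [IsManifold I (⊤ : ℕ∞) M] (f : M → ℝ) : Prop :=
  ContMDiff I 𝓘(ℝ) (⊤ : ℕ∞) f

/-- Derivative of a real valued function along a vector field. -/
def vderiv (I : ModelWithCorners ℝ E H) {M : Type*} [TopologicalSpace M] [ChartedSpace H M]
    [IsManifold I (⊤ : ℕ∞) M] (V : VF I M) (f : M → ℝ) : M → ℝ :=
  fun x => mfderiv I 𝓘(ℝ) f x (V x)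

/-- The Lie bracket of two vector fields on a manifold, defined by transporting the two
vector fields to the model space via the preferred chart at the given point, taking the
Lie bracket of vector fields there, and transporting the result back.  For smooth vector
fields this is the usual Lie bracket `[V, W]`. -/
def vfLie (I : ModelWithCorners ℝ E H) {M : Type*} [TopologicalSpace M] [ChartedSpace H M]
    [IsManifold I (⊤ : ℕ∞) M] (V W : VF I M) : VF I M := fun x₀ =>
  mfderiv 𝓘(ℝ, E) I (extChartAt I x₀).symm (extChartAt I x₀ x₀)
    ((VectorField.lieBracket ℝ
      (fun e => (mfderiv I 𝓘(ℝ, E) (extChartAt I x₀) ((extChartAt I x₀).symm e)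
        (V ((extChartAt I x₀).symm e)) : E))
      (fun e => (mfderiv I 𝓘(ℝ, E) (extChartAt I x₀) ((extChartAt I x₀).symm e)
        (W ((extChartAt I x₀).symm e)) : E))
      (extChartAt I x₀ x₀) : E))

/-- A smooth differential `1`-form on a manifold, given by its pointwise values. -/
structure OneForm (I : ModelWithCorners ℝ E H) (M : Type*) [TopologicalSpace M]
    [ChartedSpace H M] [IsManifold I (⊤ : ℕ∞) M] where
  val : ∀ x : M, TangentSpace I x →ₗ[ℝ] ℝ
  smooth' : ∀ V : VF I M, SmoothVF I V → SmoothFn I (fun x => val x (V x))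

/-- A smooth differential `k`-form on a manifold, given by its pointwise values. -/
structure FormPt (I : ModelWithCorners ℝ E H) (M : Type*) [TopologicalSpace M]
    [ChartedSpace H M] [IsManifold I (⊤ : ℕ∞) M] (k : ℕ) where
  val : ∀ x : M, (TangentSpace I x) [⋀^Fin k]→ₗ[ℝ] ℝ
  smooth' : ∀ V : Fin k → VF I M, (∀ i, SmoothVF I (V i)) →
    SmoothFn I (fun x => val x (fun i => V i x))

variable {I : ModelWithCorners ℝ E H} {M : Type*} [TopologicalSpace M] [ChartedSpace H M]
  [IsManifold I (⊤ : ℕ∞) M]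

/-- The exterior derivative of a (pointwise defined) `1`-form, evaluated on two vector
fields, via the Cartan formula `dω(V,W) = V (ω W) - W (ω V) - ω [V,W]`.  Here the `1`-form
is given as a function on vector fields. -/
def dOfFun (I : ModelWithCorners ℝ E H) {M : Type*} [TopologicalSpace M] [ChartedSpace H M]
    [IsManifold I (⊤ : ℕ∞) M] (lam : VF I M → M → ℝ) (V W : VF I M) : M → ℝ :=
  fun x => vderiv I V (lam W) x - vderiv I W (lam V) x - lam (vfLie I V W) x

/-- The exterior derivative of a `1`-form, as a function of two vector fields. -/
def OneForm.d (ω : OneForm I M) (V W : VF I M) : M → ℝ :=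
  dOfFun I (fun U x => ω.val x (U x)) V W

/-- A distribution (field of tangent subspaces) on a manifold. -/
abbrev TangentDist (I : ModelWithCorners ℝ E H) (M : Type*) [TopologicalSpace M] [ChartedSpace H M] :=
  ∀ x : M, Submodule ℝ (TangentSpace I x)

/-- A (smooth) section of a distribution. -/
def IsSection (I : ModelWithCorners ℝ E H) {M : Type*} [TopologicalSpace M] [ChartedSpace H M]
    [IsManifold I (⊤ : ℕ∞) M] (D : TangentDist I M) (V : VF I M) : Prop :=
  SmoothVF I V ∧ ∀ x, V x ∈ D x

/-- The distribution `[D, D]` generated by a distribution `D` together with all Lie brackets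
of its sections. -/
def derivedDist (I : ModelWithCorners ℝ E H) {M : Type*} [TopologicalSpace M] [ChartedSpace H M]
    [IsManifold I (⊤ : ℕ∞) M] (D : TangentDist I M) : TangentDist I M := fun x =>
  Submodule.span ℝ
    ({v | ∃ V, IsSection I D V ∧ V x = v} ∪
     {v | ∃ V W, IsSection I D V ∧ IsSection I D W ∧ vfLie I V W x = v})

/-- A distribution is integrable (in the sense of Frobenius: involutive) if Lie brackets of
its sections are again tangent to it. -/
def IsIntegrableDist (I : ModelWithCorners ℝ E H) {M : Type*} [TopologicalSpace M]
    [ChartedSpace H M] [IsManifold I (⊤ : ℕ∞) M] (D : TangentDist I M) : Prop :=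
  ∀ V W, IsSection I D V → IsSection I D W → ∀ x, vfLie I V W x ∈ D x

/-- `(ω ∧ θ)(U,V,W)` for a `1`-form `ω` and a `2`-form `θ` given as a function of two
vector fields. -/
def wedge1_2 (I : ModelWithCorners ℝ E H) {M : Type*} [TopologicalSpace M] [ChartedSpace H M]
    [IsManifold I (⊤ : ℕ∞) M] (ω : OneForm I M) (θ : VF I M → VF I M → M → ℝ)
    (U V W : VF I M) : M → ℝ := fun x =>
  ω.val x (U x) * θ V W x - ω.val x (V x) * θ U W x + ω.val x (W x) * θ U V x

/-- The square `θ ∧ θ` of a `2`-form `θ` (given as a function of two vector fields) vanishes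
identically. -/
def FormSqZero (I : ModelWithCorners ℝ E H) {M : Type*} [TopologicalSpace M] [ChartedSpace H M]
    [IsManifold I (⊤ : ℕ∞) M] (θ : VF I M → VF I M → M → ℝ) : Prop :=
  ∀ V₀ V₁ V₂ V₃ : VF I M, SmoothVF I V₀ → SmoothVF I V₁ → SmoothVF I V₂ → SmoothVF I V₃ →
    ∀ x, θ V₀ V₁ x * θ V₂ V₃ x - θ V₀ V₂ x * θ V₁ V₃ x + θ V₀ V₃ x * θ V₁ V₂ x = 0

/-- An Engel structure: a rank 2 distribution `D` such that `E := [D,D]` has rank 3 and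
`[E,E] = TM`. -/
def IsEngel (I : ModelWithCorners ℝ E H) {M : Type*} [TopologicalSpace M] [ChartedSpace H M]
    [IsManifold I (⊤ : ℕ∞) M] (D : TangentDist I M) : Prop :=
  (∀ x, Module.finrank ℝ (D x) = 2) ∧ (∀ x, Module.finrank ℝ (derivedDist I D x) = 3) ∧
  (∀ x, derivedDist I (derivedDist I D) x = ⊤)

/-- Engel defining forms: `D = ker α ∩ ker β` and `E = [D,D] = ker α`. -/
def EngelDefiningForms (I : ModelWithCorners ℝ E H) {M : Type*} [TopologicalSpace M]
    [ChartedSpace H M] [IsManifold I (⊤ : ℕ∞) M] (D : TangentDist I M)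
    (α β : OneForm I M) : Prop :=
  (∀ x, D x = LinearMap.ker (α.val x) ⊓ LinearMap.ker (β.val x)) ∧
  (∀ x, derivedDist I D x = LinearMap.ker (α.val x))

/-- The pair of Reeb vector fields `T`, `R` associated with Engel defining forms `α`, `β`:
`i_T(α ∧ dβ) = 0`, `β(T) = 1`, `α(T) = 0`, `i_R(β ∧ dβ) = 0`, `β(R) = 0`, `α(R) = 1`. -/
structure IsReebPair (I : ModelWithCorners ℝ E H) {M : Type*} [TopologicalSpace M]
    [ChartedSpace H M] [IsManifold I (⊤ : ℕ∞) M] (α β : OneForm I M)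
    (T R : VF I M) : Prop where
  smoothT : SmoothVF I T
  smoothR : SmoothVF I R
  alphaT : ∀ x, α.val x (T x) = 0
  betaT : ∀ x, β.val x (T x) = 1
  alphaR : ∀ x, α.val x (R x) = 1
  betaR : ∀ x, β.val x (R x) = 0
  insT : ∀ V W, SmoothVF I V → SmoothVF I W → ∀ x, wedge1_2 I α β.d T V W x = 0
  insR : ∀ V W, SmoothVF I V → SmoothVF I W → ∀ x, wedge1_2 I β β.d R V W x = 0

/-- The Reeb distribution spanned by the two Reeb vector fields. -/
def reebDist (I : ModelWithCorners ℝ E H) {M : Type*} [TopologicalSpace M] [ChartedSpace H M]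
    (T R : VF I M) : TangentDist I M := fun x => Submodule.span ℝ {T x, R x}

/-- `W` is a nonsingular vector field spanning the characteristic foliation of the even
contact structure `E = [D,D]`:  `W` is tangent to `D` and `[W, E] ⊆ E`. -/
def SpansChar (I : ModelWithCorners ℝ E H) {M : Type*} [TopologicalSpace M] [ChartedSpace H M]
    [IsManifold I (⊤ : ℕ∞) M] (D : TangentDist I M) (W : VF I M) : Prop :=
  SmoothVF I W ∧ (∀ x, W x ≠ 0) ∧ (∀ x, W x ∈ D x) ∧
  ∀ V, IsSection I (derivedDist I D) V → ∀ x, vfLie I W V x ∈ derivedDist I D x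

/-- A Riemannian metric, given by its pointwise values. -/
structure RMetric (I : ModelWithCorners ℝ E H) (M : Type*) [TopologicalSpace M]
    [ChartedSpace H M] [IsManifold I (⊤ : ℕ∞) M] where
  val : ∀ x : M, TangentSpace I x →ₗ[ℝ] TangentSpace I x →ₗ[ℝ] ℝ
  symm : ∀ x u v, val x u v = val x v u
  posdef : ∀ x v, v ≠ 0 → 0 < val x v v
  smooth' : ∀ V W, SmoothVF I V → SmoothVF I W → SmoothFn I (fun x => val x (V x) (W x))

/-- The Koszul formula: `koszul g X Y Z = g(∇_X Y, Z)` where `∇` is the Levi-Civita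
connection of `g`. -/
def koszul (I : ModelWithCorners ℝ E H) {M : Type*} [TopologicalSpace M] [ChartedSpace H M]
    [IsManifold I (⊤ : ℕ∞) M] (g : RMetric I M) (X Y Z : VF I M) : M → ℝ := fun x =>
  (vderiv I X (fun y => g.val y (Y y) (Z y)) x + vderiv I Y (fun y => g.val y (X y) (Z y)) x
    - vderiv I Z (fun y => g.val y (X y) (Y y)) x
    + g.val x (vfLie I X Y x) (Z x) - g.val x (vfLie I X Z x) (Y x)
    - g.val x (vfLie I Y Z x) (X x)) / 2

/-- A distribution `D` is totally geodesic for `g` iff every geodesic tangent to it at one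
point stays tangent to it; equivalently (the standard characterization, which we take as the
definition) `∇_U U` is tangent to `D` for every section `U` of `D`, i.e. `g(∇_U U, V) = 0`
for every vector field `V` orthogonal to `D`. -/
def IsTotallyGeodesic (I : ModelWithCorners ℝ E H) {M : Type*} [TopologicalSpace M]
    [ChartedSpace H M] [IsManifold I (⊤ : ℕ∞) M] (g : RMetric I M)
    (D : TangentDist I M) : Prop :=
  ∀ U, IsSection I D U → ∀ V, SmoothVF I V → (∀ x, ∀ u ∈ D x, g.val x (V x) u = 0) →
    ∀ x, koszul I g U U V x = 0

/-- A Killing vector field: `L_Z g = 0`, expressed on vector fields. -/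
def IsKilling (I : ModelWithCorners ℝ E H) {M : Type*} [TopologicalSpace M] [ChartedSpace H M]
    [IsManifold I (⊤ : ℕ∞) M] (g : RMetric I M) (Z : VF I M) : Prop :=
  ∀ V W, SmoothVF I V → SmoothVF I W → ∀ x,
    vderiv I Z (fun y => g.val y (V y) (W y)) x
      = g.val x (vfLie I Z V x) (W x) + g.val x (V x) (vfLie I Z W x)

/-- An Engel vector field: the flow of `Z` preserves `D`, i.e. `L_Z D ⊆ D`. -/
def IsEngelVF (I : ModelWithCorners ℝ E H) {M : Type*} [TopologicalSpace M] [ChartedSpace H M]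
    [IsManifold I (⊤ : ℕ∞) M] (D : TangentDist I M) (Z : VF I M) : Prop :=
  SmoothVF I Z ∧ ∀ V, IsSection I D V → ∀ x, vfLie I Z V x ∈ D x

/-- A K-Engel structure: `D` is an Engel structure, `g` a Riemannian metric and `Z` a
(nowhere vanishing) vector field which is Engel, Killing and orthogonal to `E = [D,D]`. -/
structure IsKEngel (I : ModelWithCorners ℝ E H) {M : Type*} [TopologicalSpace M]
    [ChartedSpace H M] [IsManifold I (⊤ : ℕ∞) M] (D : TangentDist I M)
    (g : RMetric I M) (Z : VF I M) : Prop where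
  engel : IsEngel I D
  engelVF : IsEngelVF I D Z
  killing : IsKilling I g Z
  orth : ∀ x, ∀ v ∈ derivedDist I D x, g.val x (Z x) v = 0
  nonzero : ∀ x, Z x ≠ 0

/-- A `1`-form is closed. -/
def OneForm.IsClosed {I : ModelWithCorners ℝ E H} {M : Type*} [TopologicalSpace M]
    [ChartedSpace H M] [IsManifold I (⊤ : ℕ∞) M] (ω : OneForm I M) : Prop :=
  ∀ V W, SmoothVF I V → SmoothVF I W → ∀ x, ω.d V W x = 0

/-- The Lie derivative `(L_Z ω)(V) = Z (ω V) - ω [Z,V]` of a `1`-form along a vector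
field, as a function of vector fields. -/
def lieOneForm (I : ModelWithCorners ℝ E H) {M : Type*} [TopologicalSpace M] [ChartedSpace H M]
    [IsManifold I (⊤ : ℕ∞) M] (ω : OneForm I M) (Z V : VF I M) : M → ℝ := fun x =>
  vderiv I Z (fun y => ω.val y (V y)) x - ω.val x (vfLie I Z V x)

/-- The exterior derivative of a pointwise-defined `(m+1)`-form evaluated on `m+2` vector
fields, via the global Koszul formula. -/
def extDerEval (I : ModelWithCorners ℝ E H) {M : Type*} [TopologicalSpace M] [ChartedSpace H M]
    [IsManifold I (⊤ : ℕ∞) M] {m : ℕ} (ν : FormPt I M (m+1)) (V : Fin (m+2) → VF I M) :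
    M → ℝ := fun x =>
  (∑ i : Fin (m+2), (-1 : ℝ)^(i : ℕ) *
    vderiv I (V i) (fun y => ν.val y (fun l => V (i.succAbove l) y)) x)
  + ∑ i : Fin (m+2), ∑ j : Fin (m+2), if h : (i : ℕ) < (j : ℕ) then
      (-1 : ℝ)^((i : ℕ)+(j : ℕ)) * ν.val x (Fin.cons (vfLie I (V i) (V j) x)
        (fun l => V (j.succAbove ((⟨(i : ℕ), by have := j.2; omega⟩ : Fin (m+1)).succAbove l)) x))
    else 0

/-- A pointwise-defined form is closed. -/
def FormPt.IsClosedForm {I : ModelWithCorners ℝ E H} {M : Type*} [TopologicalSpace M]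
    [ChartedSpace H M] [IsManifold I (⊤ : ℕ∞) M] {m : ℕ} (ν : FormPt I M (m+1)) : Prop :=
  ∀ V : Fin (m+2) → VF I M, (∀ i, SmoothVF I (V i)) → ∀ x, extDerEval I ν V x = 0

/-- `φ : ℝ → M → M` is the flow of the vector field `Z`. -/
def IsFlowOf (I : ModelWithCorners ℝ E H) {M : Type*} [TopologicalSpace M] [ChartedSpace H M]
    [IsManifold I (⊤ : ℕ∞) M] (Z : VF I M) (φ : ℝ → M → M) : Prop :=
  Continuous (fun p : ℝ × M => φ p.1 p.2) ∧ (∀ x, φ 0 x = x) ∧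
  (∀ s t x, φ (s + t) x = φ s (φ t x)) ∧
  ∀ x t, HasMFDerivAt 𝓘(ℝ) I (fun s => φ s x) t
    ((1 : ℝ →L[ℝ] ℝ).smulRight (Z (φ t x)))

/-- `(η ∧ dη ∧ dη)(V₀,...,V₄)` up to a positive constant factor, for a pointwise `1`-form
`η`; pointwise nonvanishing of this expression on frames is the contact condition in
dimension 5. -/
def contactEval (I : ModelWithCorners ℝ E H) {M : Type*} [TopologicalSpace M] [ChartedSpace H M]
    [IsManifold I (⊤ : ℕ∞) M] (η : ∀ z : M, TangentSpace I z →ₗ[ℝ] ℝ)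
    (V : Fin 5 → VF I M) : M → ℝ := fun z =>
  ∑ σ : Equiv.Perm (Fin 5), ((Equiv.Perm.sign σ : ℤ) : ℝ) *
    (η z (V (σ 0) z) * dOfFun I (fun U x => η x (U x)) (V (σ 1)) (V (σ 2)) z *
      dOfFun I (fun U x => η x (U x)) (V (σ 3)) (V (σ 4)) z)

/-! ### Lie brackets and derivatives along vector fields -/

section Calculus

lemma one_le_top_smooth : (1 : WithTop ℕ∞) ≤ ((⊤ : ℕ∞) : WithTop ℕ∞) := by
  exact_mod_cast le_top

lemma isManifold_of_natCast_smooth (n : ℕ) : IsManifold I (n : WithTop ℕ∞) M :=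
  IsManifold.of_le (n := ((⊤ : ℕ∞) : WithTop ℕ∞)) (by exact_mod_cast le_top)

lemma isManifold_one_smooth : IsManifold I 1 M :=
  IsManifold.of_le (n := ((⊤ : ℕ∞) : WithTop ℕ∞)) one_le_top_smooth

lemma SmoothVF.mdifferentiableAt {V : VF I M} (hV : SmoothVF I V) (x : M) :
    MDifferentiableAt I I.tangent (fun x => (⟨x, V x⟩ : TangentBundle I M)) x :=
  (hV x).mdifferentiableAt (by simp)

lemma SmoothFn.mdifferentiableAt {f : M → ℝ} (hf : SmoothFn I f) (x : M) :
    MDifferentiableAt I 𝓘(ℝ) f x :=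
  (hf x).mdifferentiableAt (by simp)

lemma vfLie_eq_mlieBracket [I.Boundaryless] (V W : VF I M) :
    vfLie I V W = VectorField.mlieBracket I V W := by
  have := isManifold_one_smooth (I := I) (M := M)
  ext x
  have key : ∀ U : VF I M,
      (fun e => (mfderiv I 𝓘(ℝ, E) (extChartAt I x) ((extChartAt I x).symm e)
        (U ((extChartAt I x).symm e)) : E)) =ᶠ[nhds (extChartAt I x x)]
      VectorField.mpullbackWithin 𝓘(ℝ, E) I (extChartAt I x).symm U (range I) := by
    intro U
    filter_upwards [extChartAt_target_mem_nhds (I := I) x] with e he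
    rw [VectorField.mpullbackWithin_apply]
    have h1 := mfderiv_extChartAt_comp_mfderivWithin_extChartAt_symm (I := I) he
    have h2 := mfderivWithin_extChartAt_symm_comp_mfderiv_extChartAt (I := I) he
    rw [ContinuousLinearMap.inverse_eq h2 h1]
    rfl
  have h3 : (mfderiv I 𝓘(ℝ, E) (extChartAt I x) x).inverse
      = mfderiv 𝓘(ℝ, E) I (extChartAt I x).symm (extChartAt I x x) := by
    have h1 := mfderiv_extChartAt_comp_mfderivWithin_extChartAt_symm' (I := I)
      (mem_extChartAt_source (I := I) x)
    have h2 := mfderivWithin_extChartAt_symm_comp_mfderiv_extChartAt' (I := I)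
      (mem_extChartAt_source (I := I) x)
    rw [I.range_eq_univ, mfderivWithin_univ] at h1 h2
    exact ContinuousLinearMap.inverse_eq h1 h2
  rw [← VectorField.mlieBracketWithin_univ, VectorField.mlieBracketWithin_apply, h3]
  unfold vfLie
  rw [preimage_univ, univ_inter]
  have h4 := (key V).lieBracket_vectorField_eq (𝕜 := ℝ) (key W)
  have h5 : ∀ A B : E → E, VectorField.lieBracketWithin ℝ A B (range I) (extChartAt I x x)
      = VectorField.lieBracket ℝ A B (extChartAt I x x) := by
    intro A B
    rw [I.range_eq_univ, VectorField.lieBracketWithin_univ]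
  exact congrArg (mfderiv 𝓘(ℝ, E) I (extChartAt I x).symm (extChartAt I x x))
    (h4.trans (h5 _ _).symm)

lemma SmoothVF.add {V W : VF I M} (hV : SmoothVF I V) (hW : SmoothVF I W) :
    SmoothVF I (V + W) := ContMDiff.add_section hV hW

lemma SmoothVF.smul {f : M → ℝ} {V : VF I M} (hf : SmoothFn I f) (hV : SmoothVF I V) :
    SmoothVF I (f • V) := ContMDiff.smul_section hf hV

lemma SmoothFn.mul {f g : M → ℝ} (hf : SmoothFn I f) (hg : SmoothFn I g) :
    SmoothFn I (fun x => f x * g x) := ContMDiff.mul hf hg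

lemma SmoothFn.neg {f : M → ℝ} (hf : SmoothFn I f) : SmoothFn I (fun x => -f x) :=
  ContMDiff.neg hf

lemma SmoothFn.sub {f g : M → ℝ} (hf : SmoothFn I f) (hg : SmoothFn I g) :
    SmoothFn I (fun x => f x - g x) := ContMDiff.sub hf hg

lemma SmoothFn.const (c : ℝ) : SmoothFn I (fun _ : M => c) := contMDiff_const

lemma SmoothFn.inv {f : M → ℝ} (hf : SmoothFn I f) (h : ∀ x, f x ≠ 0) :
    SmoothFn I (fun x => (f x)⁻¹) := ContMDiff.inv₀ hf h

lemma SmoothFn.div {f g : M → ℝ} (hf : SmoothFn I f) (hg : SmoothFn I g) (h : ∀ x, g x ≠ 0) :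
    SmoothFn I (fun x => f x / g x) := ContMDiff.div₀ hf hg h

lemma SmoothFn.sqrt {f : M → ℝ} (hf : SmoothFn I f) (h : ∀ x, f x ≠ 0) :
    SmoothFn I (fun x => √(f x)) := fun x =>
  ((Real.contDiffAt_sqrt (h x)).contMDiffAt).comp x (hf x)

lemma SmoothFn.sum {ι : Type*} (s : Finset ι) {f : ι → M → ℝ} (hf : ∀ i, SmoothFn I (f i)) :
    SmoothFn I (fun x => ∑ i ∈ s, f i x) :=
  contMDiff_finsetSum (fun i _ => hf i)

lemma SmoothFn.prod {ι : Type*} (s : Finset ι) {f : ι → M → ℝ} (hf : ∀ i, SmoothFn I (f i)) :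
    SmoothFn I (fun x => ∏ i ∈ s, f i x) :=
  contMDiff_finsetProd (fun i _ => hf i)

lemma SmoothVF.zero : SmoothVF I (0 : VF I M) := Bundle.contMDiff_zeroSection ℝ (TangentSpace I)

lemma SmoothVF.sum {ι : Type*} (s : Finset ι) {V : ι → VF I M} (hV : ∀ i, SmoothVF I (V i)) :
    SmoothVF I (∑ i ∈ s, V i) := by
  classical
  induction s using Finset.induction_on with
  | empty => simpa using SmoothVF.zero
  | insert i s hi ih => rw [Finset.sum_insert hi]; exact (hV i).add ih

lemma SmoothVF.vfLie [I.Boundaryless] [CompleteSpace E] {V W : VF I M}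
    (hV : SmoothVF I V) (hW : SmoothVF I W) : SmoothVF I (vfLie I V W) := by
  rw [vfLie_eq_mlieBracket]
  have : IsManifold I (((⊤ : ℕ∞) : WithTop ℕ∞) + 1) M := by
    simpa using (inferInstance : IsManifold I ((⊤ : ℕ∞) : WithTop ℕ∞) M)
  have : IsManifold I (minSmoothness ℝ 2) M := by
    simpa using isManifold_of_natCast_smooth (I := I) (M := M) 2
  exact ContDiff.mlieBracket_vectorField (n := ⊤) (m := ⊤) hV hW (by simp)

lemma vfLie_swap [I.Boundaryless] (V W : VF I M) (x : M) :
    vfLie I V W x = -vfLie I W V x := by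
  simp only [vfLie_eq_mlieBracket]; exact VectorField.mlieBracket_swap_apply

lemma vfLie_self [I.Boundaryless] (V : VF I M) (x : M) : vfLie I V V x = 0 := by
  have h := vfLie_swap V V x
  have h2 : (2 : ℝ) • vfLie I V V x = 0 := by rw [two_smul]; nth_rewrite 1 [h]; simp
  simpa using h2

lemma vfLie_add_right [I.Boundaryless] [CompleteSpace E] (U : VF I M) {V W : VF I M}
    (hV : SmoothVF I V) (hW : SmoothVF I W) (x : M) :
    vfLie I U (V + W) x = vfLie I U V x + vfLie I U W x := by
  have := isManifold_one_smooth (I := I) (M := M)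
  simp only [vfLie_eq_mlieBracket]
  exact VectorField.mlieBracket_add_right (hV.mdifferentiableAt x) (hW.mdifferentiableAt x)

lemma vfLie_add_left [I.Boundaryless] [CompleteSpace E] (U : VF I M) {V W : VF I M}
    (hV : SmoothVF I V) (hW : SmoothVF I W) (x : M) :
    vfLie I (V + W) U x = vfLie I V U x + vfLie I W U x := by
  rw [vfLie_swap, vfLie_add_right U hV hW, neg_add, ← vfLie_swap, ← vfLie_swap]

lemma vfLie_smul_right [I.Boundaryless] [CompleteSpace E] (V : VF I M) {f : M → ℝ} {W : VF I M}
    (hf : SmoothFn I f) (hW : SmoothVF I W) (x : M) :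
    vfLie I V (f • W) x = vderiv I V f x • W x + f x • vfLie I V W x := by
  have := isManifold_one_smooth (I := I) (M := M)
  simp only [vfLie_eq_mlieBracket]
  exact VectorField.mlieBracket_smul_right (hf.mdifferentiableAt x) (hW.mdifferentiableAt x)

lemma vfLie_smul_left [I.Boundaryless] [CompleteSpace E] (V : VF I M) {f : M → ℝ} {W : VF I M}
    (hf : SmoothFn I f) (hW : SmoothVF I W) (x : M) :
    vfLie I (f • W) V x = -vderiv I V f x • W x + f x • vfLie I W V x := by
  rw [vfLie_swap, vfLie_smul_right V hf hW, neg_add, vfLie_swap W V, neg_smul, smul_neg]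

lemma vfLie_jacobi [I.Boundaryless] [CompleteSpace E] {U V W : VF I M}
    (hU : SmoothVF I U) (hV : SmoothVF I V) (hW : SmoothVF I W) (x : M) :
    vfLie I U (vfLie I V W) x = vfLie I (vfLie I U V) W x + vfLie I V (vfLie I U W) x := by
  have : IsManifold I (minSmoothness ℝ 3) M := by
    simpa using isManifold_of_natCast_smooth (I := I) (M := M) 3
  have h : minSmoothness ℝ 2 ≤ ((⊤ : ℕ∞) : WithTop ℕ∞) := by
    simpa using (WithTop.coe_le_coe.mpr le_top : ((2 : ℕ∞) : WithTop ℕ∞) ≤ ((⊤ : ℕ∞) : WithTop ℕ∞))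
  simp only [vfLie_eq_mlieBracket]
  exact VectorField.leibniz_identity_mlieBracket_apply ((hU x).of_le h) ((hV x).of_le h)
    ((hW x).of_le h)

lemma vderiv_add {f g : M → ℝ} (V : VF I M) (hf : SmoothFn I f) (hg : SmoothFn I g) (x : M) :
    vderiv I V (fun y => f y + g y) x = vderiv I V f x + vderiv I V g x := by
  have := mfderiv_add (hf.mdifferentiableAt x) (hg.mdifferentiableAt x)
  exact DFunLike.congr_fun this (V x)

lemma vderiv_mul {f g : M → ℝ} (V : VF I M) (hf : SmoothFn I f) (hg : SmoothFn I g) (x : M) :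
    vderiv I V (fun y => f y * g y) x = f x * vderiv I V g x + g x * vderiv I V f x := by
  have := ((hf.mdifferentiableAt x).hasMFDerivAt.mul (hg.mdifferentiableAt x).hasMFDerivAt).mfderiv
  exact DFunLike.congr_fun this (V x)

lemma vderiv_neg {f : M → ℝ} (V : VF I M) (x : M) :
    vderiv I V (fun y => -f y) x = -vderiv I V f x := by
  have := mfderiv_neg (I := I) (f := f) (x := x)
  exact DFunLike.congr_fun this (V x)

lemma vderiv_const (V : VF I M) (c : ℝ) (x : M) : vderiv I V (fun _ => c) x = 0 := by
  have := mfderiv_const (I := I) (I' := 𝓘(ℝ)) (x := x) (c := c)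
  exact DFunLike.congr_fun this (V x)

lemma vderiv_add_field (V W : VF I M) (f : M → ℝ) (x : M) :
    vderiv I (V + W) f x = vderiv I V f x + vderiv I W f x :=
  map_add (mfderiv I 𝓘(ℝ) f x) (V x) (W x)

lemma vderiv_smul_field (g : M → ℝ) (V : VF I M) (f : M → ℝ) (x : M) :
    vderiv I (g • V) f x = g x * vderiv I V f x :=
  map_smul (mfderiv I 𝓘(ℝ) f x) (g x) (V x)

end Calculus

/-! ### Global frames -/

section Frame

variable {ι : Type*} [Fintype ι] [DecidableEq ι]

/-- A global smooth frame of the tangent bundle. -/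
structure IsGlobalFrame (I : ModelWithCorners ℝ E H) {M : Type*} [TopologicalSpace M]
    [ChartedSpace H M] [IsManifold I (⊤ : ℕ∞) M] (e : ι → VF I M) : Prop where
  smooth : ∀ i, SmoothVF I (e i)
  indep : ∀ x, LinearIndependent ℝ (fun i => e i x)
  span : ∀ x, ⊤ ≤ Submodule.span ℝ (range (fun i => e i x))

/-- The basis of a tangent space given by a global frame. -/
def IsGlobalFrame.basis {e : ι → VF I M} (h : IsGlobalFrame I e) (x : M) :
    Basis ι ℝ (TangentSpace I x) := Basis.mk (h.indep x) (h.span x)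

omit [Fintype ι] [DecidableEq ι] in
lemma IsGlobalFrame.basis_apply {e : ι → VF I M} (h : IsGlobalFrame I e) (x : M) (i : ι) :
    h.basis x i = e i x := Basis.mk_apply _ _ _

/-- The coefficients of a smooth vector field with respect to pointwise linearly independent
smooth vector fields are smooth. -/
lemma smoothFn_coeff [FiniteDimensional ℝ E] {e : ι → VF I M} (he : ∀ i, SmoothVF I (e i))
    (hind : ∀ x, LinearIndependent ℝ (fun i => e i x)) {V : VF I M} (hV : SmoothVF I V)
    {c : ι → M → ℝ} (hc : ∀ x, V x = ∑ j, c j x • e j x) (i : ι) : SmoothFn I (c i) := by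
  intro x₀
  let t := trivializationAt E (TangentSpace I) x₀
  have hx₀ : x₀ ∈ t.baseSet := FiberBundle.mem_baseSet_trivializationAt' x₀
  have := isManifold_one_smooth (I := I) (M := M)
  have hind₀ : LinearIndependent ℝ (fun j => (t ⟨x₀, e j x₀⟩).2) :=
    (hind x₀).map' (t.linearEquivAt ℝ x₀ hx₀).toLinearMap (LinearEquiv.ker _)
  obtain ⟨g, hg⟩ := LinearMap.exists_leftInverse_of_injective
    (Fintype.linearCombination ℝ (fun j => (t ⟨x₀, e j x₀⟩).2))
    (LinearMap.ker_eq_bot.2 (hind₀.fintypeLinearCombination_injective))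
  have hsm : ∀ U : VF I M, SmoothVF I U → ∀ k,
      ContMDiffAt I 𝓘(ℝ) (⊤ : ℕ∞) (fun y => g (t ⟨y, U y⟩).2 k) x₀ := by
    intro U hU k
    have h1 : ContMDiffAt I 𝓘(ℝ, E) (⊤ : ℕ∞) (fun y => (t ⟨y, U y⟩).2) x₀ :=
      (t.contMDiffAt_section_iff hx₀).1 (hU x₀)
    have h2 : ContMDiffAt 𝓘(ℝ, E) 𝓘(ℝ) (⊤ : ℕ∞)
        ((LinearMap.proj k ∘ₗ g : E →ₗ[ℝ] ℝ).toContinuousLinearMap) (t ⟨x₀, U x₀⟩).2 :=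
      (LinearMap.toContinuousLinearMap _).contMDiff.contMDiffAt
    exact h2.comp x₀ h1
  have hdet : ∀ U : ι → VF I M, (∀ j, SmoothVF I (U j)) → ContMDiffAt I 𝓘(ℝ) (⊤ : ℕ∞)
      (fun y => Matrix.detRowAlternating (fun j => g (t ⟨y, U j y⟩).2)) x₀ := by
    intro U hU
    change ContMDiffAt I 𝓘(ℝ) (⊤ : ℕ∞)
      (fun y => Matrix.det (Matrix.of fun j => g (t ⟨y, U j y⟩).2)) x₀
    simp only [Matrix.det_apply, Units.smul_def, zsmul_eq_mul]
    refine contMDiffAt_finsetSum fun σ _ => ?_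
    exact contMDiffAt_const.mul (contMDiffAt_finsetProd fun i _ => hsm _ (hU _) _)
  have hN := hdet (update e i V) fun j => by
    by_cases hj : j = i
    · subst hj; simpa using hV
    · simpa [hj] using he j
  have hD := hdet e he
  have hne : Matrix.detRowAlternating (fun j => g (t ⟨x₀, e j x₀⟩).2) ≠ (0 : ℝ) := by
    have h1 : (fun j => g (t ⟨x₀, e j x₀⟩).2) = (1 : Matrix ι ι ℝ) := by
      ext1 j
      have := LinearMap.congr_fun hg (Pi.single j 1)
      simp only [LinearMap.comp_apply, Fintype.linearCombination_apply_single, one_smul,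
        LinearMap.id_apply] at this
      rw [this]
      ext k
      simp [Matrix.one_apply, Pi.single_apply, eq_comm]
    rw [h1]
    exact Matrix.det_one.trans_ne one_ne_zero
  refine (hN.div₀ hD hne).congr_of_eventuallyEq ?_
  filter_upwards [t.open_baseSet.mem_nhds hx₀, hD.continuousAt.eventually_ne hne] with y hy hney
  rw [Pi.div_apply, eq_div_iff hney]
  let L : TangentSpace I y →ₗ[ℝ] (ι → ℝ) := g ∘ₗ (t.linearEquivAt ℝ y hy).toLinearMap
  have h3 : (fun j => g (t ⟨y, update e i V j y⟩).2)
      = update (fun j => L (e j y)) i (L (V y)) := by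
    ext1 j
    by_cases hj : j = i
    · subst hj; simp only [update_self]; rfl
    · simp only [update_of_ne hj]; rfl
  have h4 : L (V y) = ∑ j, c j y • L (e j y) := by
    rw [hc, map_sum]
    exact Finset.sum_congr rfl fun j _ => map_smul _ _ _
  rw [h3, h4, AlternatingMap.map_update_sum, Finset.sum_eq_single i]
  · rw [AlternatingMap.map_update_smul, update_eq_self]
    rfl
  · intro j _ hj
    rw [AlternatingMap.map_update_smul, AlternatingMap.map_update_self _ _ hj.symm, smul_zero]
  · simp

lemma IsGlobalFrame.smoothFn_coord [FiniteDimensional ℝ E] {e : ι → VF I M}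
    (h : IsGlobalFrame I e) (i : ι) {V : VF I M} (hV : SmoothVF I V) :
    SmoothFn I (fun x => (h.basis x).coord i (V x)) := by
  refine smoothFn_coeff h.smooth h.indep hV (c := fun i x => (h.basis x).coord i (V x))
    (fun x => ?_) i
  conv_lhs => rw [← (h.basis x).sum_repr (V x)]
  refine Finset.sum_congr rfl fun j _ => ?_
  rw [h.basis_apply]
  rfl

/-- The coframe dual to a global frame. -/
def IsGlobalFrame.coframe [FiniteDimensional ℝ E] {e : ι → VF I M}
    (h : IsGlobalFrame I e) (i : ι) : OneForm I M where
  val x := (h.basis x).coord i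
  smooth' _ hV := h.smoothFn_coord i hV

variable [FiniteDimensional ℝ E] {e : ι → VF I M}

lemma IsGlobalFrame.coframe_frame (h : IsGlobalFrame I e) (i j : ι) (x : M) :
    (h.coframe i).val x (e j x) = if j = i then 1 else 0 := by
  rw [← h.basis_apply]
  simp [IsGlobalFrame.coframe, Finsupp.single_apply]

lemma IsGlobalFrame.sum_coframe (h : IsGlobalFrame I e) (x : M) (v : TangentSpace I x) :
    ∑ i, (h.coframe i).val x v • e i x = v := by
  conv_rhs => rw [← (h.basis x).sum_repr v]
  refine Finset.sum_congr rfl fun j _ => ?_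
  rw [h.basis_apply]
  rfl

lemma IsGlobalFrame.exists_smoothVF (h : IsGlobalFrame I e) (x : M) (v : TangentSpace I x) :
    ∃ V : VF I M, SmoothVF I V ∧ V x = v := by
  refine ⟨∑ i, (fun _ => (h.coframe i).val x v) • e i,
    SmoothVF.sum _ fun i => (h.smooth i).smul (SmoothFn.const _), ?_⟩
  rw [Finset.sum_apply]
  exact h.sum_coframe x v

omit [DecidableEq ι] [FiniteDimensional ℝ E] in
lemma tensorial_sum {F : VF I M → ℝ} {x : M}
    (hadd : ∀ V W, SmoothVF I V → SmoothVF I W → F (V + W) = F V + F W)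
    (hsmul : ∀ f V, SmoothFn I f → SmoothVF I V → F (f • V) = f x * F V)
    (he : ∀ i, SmoothVF I (e i)) {c : ι → M → ℝ} (hc : ∀ i, SmoothFn I (c i)) :
    F (∑ i, c i • e i) = ∑ i, c i x * F (e i) := by
  classical
  have h0 : F 0 = 0 := by
    have := hsmul (fun _ => 0) 0 (SmoothFn.const 0) SmoothVF.zero
    simpa using this
  have key : ∀ s : Finset ι, F (∑ i ∈ s, c i • e i) = ∑ i ∈ s, c i x * F (e i) := by
    intro s
    induction s using Finset.induction_on with
    | empty => simpa using h0
    | insert i s hi ih =>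
      rw [Finset.sum_insert hi, Finset.sum_insert hi,
        hadd _ _ ((he i).smul (hc i)) (SmoothVF.sum _ fun j => (he j).smul (hc j)),
        hsmul _ _ (hc i) (he i), ih]
  exact key _

/-- A functional on vector fields that is linear over smooth functions is determined by its
values on a frame. -/
lemma IsGlobalFrame.tensorial_eq_sum (h : IsGlobalFrame I e) {F : VF I M → ℝ} {x : M}
    (hadd : ∀ V W, SmoothVF I V → SmoothVF I W → F (V + W) = F V + F W)
    (hsmul : ∀ f V, SmoothFn I f → SmoothVF I V → F (f • V) = f x * F V)
    {V : VF I M} (hV : SmoothVF I V) :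
    F V = ∑ i, (h.coframe i).val x (V x) * F (e i) := by
  have hVe : V = ∑ i, (fun y => (h.coframe i).val y (V y)) • e i := by
    ext y
    rw [Finset.sum_apply]
    exact (h.sum_coframe y (V y)).symm
  conv_lhs => rw [hVe]
  exact tensorial_sum hadd hsmul h.smooth fun i => (h.coframe i).smooth' V hV

lemma IsGlobalFrame.smoothFn_vderiv [I.Boundaryless] (h : IsGlobalFrame I e) (i : ι) {V : VF I M}
    (hV : SmoothVF I V) {f : M → ℝ} (hf : SmoothFn I f) : SmoothFn I (vderiv I V f) := by
  have hi := h.smooth i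
  have := FiniteDimensional.complete ℝ E
  have h1 := (h.coframe i).smooth' _ (hV.vfLie (hi.smul hf))
  have h2 := hf.mul ((h.coframe i).smooth' _ (hV.vfLie hi))
  convert h1.sub h2 using 1
  ext x
  rw [vfLie_smul_right V hf hi, map_add, map_smul, map_smul, h.coframe_frame]
  simp

end Frame

/-! ### The exterior derivative of a one-form -/

section OneFormD

variable [I.Boundaryless] [CompleteSpace E] (ω : OneForm I M)

omit [CompleteSpace E] in
lemma OneForm.d_swap (V W : VF I M) (x : M) : ω.d V W x = -ω.d W V x := by
  simp only [OneForm.d, dOfFun, vfLie_swap V W, map_neg]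
  ring

omit [CompleteSpace E] in
lemma OneForm.d_self (V : VF I M) (x : M) : ω.d V V x = 0 := by
  have := ω.d_swap V V x
  linarith

lemma OneForm.d_add_right (U : VF I M) {V W : VF I M} (hV : SmoothVF I V) (hW : SmoothVF I W)
    (x : M) : ω.d U (V + W) x = ω.d U V x + ω.d U W x := by
  have h := vderiv_add U (ω.smooth' V hV) (ω.smooth' W hW) x
  simp only [OneForm.d, dOfFun, vfLie_add_right U hV hW, Pi.add_apply, map_add,
    vderiv_add_field, h]
  ring

lemma OneForm.d_smul_right (U : VF I M) {f : M → ℝ} {V : VF I M}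
    (hf : SmoothFn I f) (hV : SmoothVF I V) (x : M) :
    ω.d U (f • V) x = f x * ω.d U V x := by
  have h := vderiv_mul U hf (ω.smooth' V hV) x
  simp only [OneForm.d, dOfFun, vfLie_smul_right U hf hV, Pi.smul_apply', map_add, map_smul,
    smul_eq_mul, vderiv_smul_field, h]
  ring

omit [CompleteSpace E] in
lemma OneForm.d_eq_sum [FiniteDimensional ℝ E] {ι : Type*} [Fintype ι] [DecidableEq ι]
    {e : ι → VF I M} (h : IsGlobalFrame I e) (V : VF I M) {W : VF I M}
    (hW : SmoothVF I W) (x : M) :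
    ω.d V W x = ∑ i, (h.coframe i).val x (W x) * ω.d V (e i) x := by
  have := FiniteDimensional.complete ℝ E
  exact h.tensorial_eq_sum (F := fun W => ω.d V W x)
    (fun _ _ h1 h2 => ω.d_add_right V h1 h2 x) (fun _ _ h1 h2 => ω.d_smul_right V h1 h2 x) hW

omit [CompleteSpace E] in
lemma OneForm.smoothFn_d [FiniteDimensional ℝ E] {ι : Type*} [Fintype ι] [DecidableEq ι]
    {e : ι → VF I M} (h : IsGlobalFrame I e) (i : ι) {V W : VF I M}
    (hV : SmoothVF I V) (hW : SmoothVF I W) : SmoothFn I (ω.d V W) := by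
  have := FiniteDimensional.complete ℝ E
  exact ((h.smoothFn_vderiv i hV (ω.smooth' W hW)).sub
    (h.smoothFn_vderiv i hW (ω.smooth' V hV))).sub (ω.smooth' _ (hV.vfLie hW))

end OneFormD

/-! ### The frame of an Engel structure -/

section EngelFrame

variable [FiniteDimensional ℝ E] [I.Boundaryless] {ι : Type*} [Fintype ι]

omit [FiniteDimensional ℝ E] in
lemma vfLie_sum_mem_right [CompleteSpace E] {e : ι → VF I M} (he : ∀ i, SmoothVF I (e i))
    {c : ι → M → ℝ} (hc : ∀ i, SmoothFn I (c i)) (U : VF I M) {x : M}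
    {S : Submodule ℝ (TangentSpace I x)} (h₁ : ∀ i, e i x ∈ S)
    (h₂ : ∀ i, vfLie I U (e i) x ∈ S) : vfLie I U (∑ i, c i • e i) x ∈ S := by
  classical
  have h0 : vfLie I U 0 x = 0 := by
    have := vfLie_smul_right U (SmoothFn.const (I := I) (M := M) 0) SmoothVF.zero x
    simpa [vderiv_const] using this
  have key : ∀ s : Finset ι, vfLie I U (∑ i ∈ s, c i • e i) x ∈ S := by
    intro s
    induction s using Finset.induction_on with
    | empty => simp [h0]
    | insert i s hi ih =>
      rw [Finset.sum_insert hi, vfLie_add_right U ((he i).smul (hc i))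
        (SmoothVF.sum _ fun j => (he j).smul (hc j)), vfLie_smul_right U (hc i) (he i)]
      exact S.add_mem (S.add_mem (S.smul_mem _ (h₁ i)) (S.smul_mem _ (h₂ i))) ih
  exact key _

variable [DecidableEq ι]

omit [I.Boundaryless] in
lemma exists_smooth_coeff {e : ι → VF I M} (he : ∀ i, SmoothVF I (e i))
    (hind : ∀ x, LinearIndependent ℝ (fun i => e i x)) {V : VF I M} (hV : SmoothVF I V)
    (hmem : ∀ x, V x ∈ Submodule.span ℝ (range fun i => e i x)) :
    ∃ c : ι → M → ℝ, (∀ i, SmoothFn I (c i)) ∧ V = ∑ i, c i • e i := by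
  choose c hc using fun x => (Submodule.mem_span_range_iff_exists_fun ℝ).1 (hmem x)
  refine ⟨fun i x => c x i, fun i => smoothFn_coeff he hind hV (fun x => (hc x).symm) i, ?_⟩
  ext x
  rw [Finset.sum_apply]
  exact (hc x).symm

/-- If `D` is framed by the fields `e i`, then `[D, D]` is contained in every subspace containing
the fields `e i` and their brackets. -/
lemma derivedDist_le {D : TangentDist I M} {e : ι → VF I M} (he : ∀ i, SmoothVF I (e i))
    (hind : ∀ x, LinearIndependent ℝ (fun i => e i x))
    (hD : ∀ x, D x = Submodule.span ℝ (range fun i => e i x)) {x : M}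
    {S : Submodule ℝ (TangentSpace I x)} (h₁ : ∀ i, e i x ∈ S)
    (h₂ : ∀ i j, vfLie I (e i) (e j) x ∈ S) : derivedDist I D x ≤ S := by
  have := FiniteDimensional.complete ℝ E
  refine Submodule.span_le.2 ?_
  rintro v (⟨V, hV, rfl⟩ | ⟨V, U, hV, hU, rfl⟩)
  · have h3 := hV.2 x
    rw [hD] at h3
    exact Submodule.span_le.2 (by rintro _ ⟨i, rfl⟩; exact h₁ i) h3
  · obtain ⟨c, hc, rfl⟩ := exists_smooth_coeff he hind hV.1 fun y => hD y ▸ hV.2 y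
    obtain ⟨c', hc', rfl⟩ := exists_smooth_coeff he hind hU.1 fun y => hD y ▸ hU.2 y
    refine vfLie_sum_mem_right he hc' _ h₁ fun j => ?_
    rw [vfLie_swap]
    refine S.neg_mem (vfLie_sum_mem_right he hc _ h₁ fun i => h₂ j i)

end EngelFrame

section Engel

variable [FiniteDimensional ℝ E] [I.Boundaryless]

/-- `W` and `X` frame the Engel structure `D`, with `W` spanning the characteristic foliation, and
together with the brackets `Y = [W, X]` and `Z = [X, Y]` they frame the tangent bundle, in a way
adapted to the flag `D ⊂ [D, D]`. -/
structure IsEngelFrame (D : TangentDist I M) (W X Y Z : VF I M) : Prop where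
  frame : IsGlobalFrame I ![W, X, Y, Z]
  lieWX : vfLie I W X = Y
  lieXY : vfLie I X Y = Z
  mem_dist : ∀ x (v : TangentSpace I x), v ∈ D x ↔
    (frame.coframe 2).val x v = 0 ∧ (frame.coframe 3).val x v = 0
  mem_derived : ∀ x (v : TangentSpace I x), v ∈ derivedDist I D x ↔ (frame.coframe 3).val x v = 0
  char : ∀ x, (frame.coframe 3).val x (vfLie I W Y x) = 0

lemma isEngelFrame_of_isEngel (hE : Module.finrank ℝ E = 4) {D : TangentDist I M}
    (hD : IsEngel I D) {W X : VF I M} (hW : SpansChar I D W) (hX : SmoothVF I X)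
    (hspan : ∀ x, D x = Submodule.span ℝ {W x, X x}) :
    IsEngelFrame D W X (vfLie I W X) (vfLie I X (vfLie I W X)) := by
  have := FiniteDimensional.complete ℝ E
  set Y := vfLie I W X with hY
  set Z := vfLie I X Y with hZ
  have hYs : SmoothVF I Y := hW.1.vfLie hX
  have hZs : SmoothVF I Z := hX.vfLie hYs
  let e₄ : Fin 4 → VF I M := ![W, X, Y, Z]
  let e₂ : Fin 2 → VF I M := ![W, X]
  let e₃ : Fin 3 → VF I M := ![W, X, Y]
  have he₂ : ∀ i, SmoothVF I (e₂ i) := by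
    intro i; fin_cases i
    exacts [hW.1, hX]
  have he₃ : ∀ i, SmoothVF I (e₃ i) := by
    intro i; fin_cases i
    exacts [hW.1, hX, hYs]
  have he₄ : ∀ i, SmoothVF I (e₄ i) := by
    intro i; fin_cases i
    exacts [hW.1, hX, hYs, hZs]
  have hr₂ : ∀ x, range (fun i => e₂ i x) = {W x, X x} := by
    intro x
    ext v
    simp [e₂, Fin.exists_fin_two, eq_comm]
  have hD₂ : ∀ x, D x = Submodule.span ℝ (range fun i => e₂ i x) := by
    intro x; rw [hr₂, hspan]
  have hi₂ : ∀ x, LinearIndependent ℝ (fun i => e₂ i x) := by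
    intro x
    rw [linearIndependent_iff_card_eq_finrank_span, Set.finrank, ← hD₂, hD.1 x]
    rfl
  have hle₃ : ∀ x, derivedDist I D x ≤ Submodule.span ℝ (range fun i => e₃ i x) := by
    intro x
    have hm : ∀ i, e₃ i x ∈ Submodule.span ℝ (range fun i => e₃ i x) :=
      fun i => Submodule.subset_span ⟨i, rfl⟩
    refine derivedDist_le he₂ hi₂ hD₂ ?_ ?_
    · intro i; fin_cases i
      exacts [hm 0, hm 1]
    · intro i j
      fin_cases i <;> fin_cases j
      · change vfLie I W W x ∈ _
        rw [vfLie_self]; exact zero_mem _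
      · exact hm 2
      · change vfLie I X W x ∈ _
        rw [vfLie_swap]; exact neg_mem (hm 2)
      · change vfLie I X X x ∈ _
        rw [vfLie_self]; exact zero_mem _
  have hfin : ∀ x : M, Module.finrank ℝ (TangentSpace I x) = 4 := fun x => hE
  have hfd : ∀ x : M, FiniteDimensional ℝ (TangentSpace I x) := fun x => ‹FiniteDimensional ℝ E›
  have hD₃ : ∀ x, derivedDist I D x = Submodule.span ℝ (range fun i => e₃ i x) := by
    intro x
    refine Submodule.eq_of_le_of_finrank_le (hle₃ x) ?_
    rw [hD.2.1 x]
    exact (finrank_range_le_card (R := ℝ) (fun i => e₃ i x)).trans (by simp)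
  have hi₃ : ∀ x, LinearIndependent ℝ (fun i => e₃ i x) := by
    intro x
    rw [linearIndependent_iff_card_eq_finrank_span, Set.finrank, ← hD₃, hD.2.1 x]
    rfl
  have hYE : IsSection I (derivedDist I D) Y :=
    ⟨hYs, fun x => by rw [hD₃]; exact Submodule.subset_span ⟨2, rfl⟩⟩
  have h34 : ∀ x, Submodule.span ℝ (range fun i => e₃ i x)
      ≤ Submodule.span ℝ (range fun i => e₄ i x) := by
    intro x
    refine Submodule.span_mono ?_
    rintro _ ⟨i, rfl⟩
    fin_cases i
    exacts [⟨0, rfl⟩, ⟨1, rfl⟩, ⟨2, rfl⟩]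
  have hspan₄ : ∀ x, ⊤ ≤ Submodule.span ℝ (range fun i => e₄ i x) := by
    intro x
    rw [← hD.2.2 x]
    have hm : ∀ i, e₄ i x
        ∈ Submodule.span ℝ (range fun i => e₄ i x) :=
      fun i => Submodule.subset_span ⟨i, rfl⟩
    have hWY : vfLie I W Y x ∈ Submodule.span ℝ (range fun i => e₄ i x) :=
      h34 x (hD₃ x ▸ hW.2.2.2 Y hYE x)
    refine derivedDist_le he₃ hi₃ hD₃ ?_ ?_
    · exact fun i => h34 x (Submodule.subset_span ⟨i, rfl⟩)
    · have h : ∀ i j, i < j → vfLie I (e₃ i) (e₃ j) x ∈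
          Submodule.span ℝ (range fun i => e₄ i x) := by
        intro i j hij
        fin_cases i <;> fin_cases j <;> first | exact absurd hij (by decide) | skip
        exacts [hm 2, hWY, hm 3]
      intro i j
      rcases lt_trichotomy i j with hij | rfl | hij
      · exact h i j hij
      · rw [vfLie_self]; exact zero_mem _
      · rw [vfLie_swap]; exact neg_mem (h j i hij)
  have hfr : IsGlobalFrame I e₄ :=
    ⟨he₄, fun x => linearIndependent_of_top_le_span_of_card_eq_finrank (hspan₄ x)
      (by rw [hfin]; rfl), hspan₄⟩
  have hco : ∀ i j x, (hfr.coframe i).val x (e₄ j x) = if j = i then 1 else 0 :=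
    fun i j x => hfr.coframe_frame i j x
  have hmem : ∀ x (v : TangentSpace I x),
      v ∈ derivedDist I D x ↔ (hfr.coframe 3).val x v = 0 := by
    intro x v
    rw [hD₃]
    constructor
    · intro hv
      have : Submodule.span ℝ (range fun i => e₃ i x)
          ≤ LinearMap.ker ((hfr.coframe 3).val x) := by
        refine Submodule.span_le.2 ?_
        rintro _ ⟨i, rfl⟩
        fin_cases i
        exacts [hco 3 0 x, hco 3 1 x, hco 3 2 x]
      exact this hv
    · intro hv
      rw [← hfr.sum_coframe x v, Fin.sum_univ_four, hv, zero_smul, add_zero]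
      have hm : ∀ i, e₃ i x ∈ Submodule.span ℝ (range fun i => e₃ i x) :=
        fun i => Submodule.subset_span ⟨i, rfl⟩
      exact add_mem (add_mem (Submodule.smul_mem _ _ (hm 0)) (Submodule.smul_mem _ _ (hm 1)))
        (Submodule.smul_mem _ _ (hm 2))
  refine ⟨hfr, rfl, rfl, fun x v => ?_, hmem, fun x => (hmem x _).1 (hW.2.2.2 Y hYE x)⟩
  rw [hD₂]
  constructor
  · intro hv
    have : Submodule.span ℝ (range fun i => e₂ i x)
        ≤ LinearMap.ker ((hfr.coframe 2).val x) ⊓ LinearMap.ker ((hfr.coframe 3).val x) := by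
      refine Submodule.span_le.2 ?_
      rintro _ ⟨i, rfl⟩
      fin_cases i
      exacts [⟨hco 2 0 x, hco 3 0 x⟩, ⟨hco 2 1 x, hco 3 1 x⟩]
    exact this hv
  · rintro ⟨h2, h3⟩
    rw [← hfr.sum_coframe x v, Fin.sum_univ_four, h2, h3, zero_smul, add_zero, zero_smul, add_zero]
    have hm : ∀ i, e₂ i x ∈ Submodule.span ℝ (range fun i => e₂ i x) :=
      fun i => Submodule.subset_span ⟨i, rfl⟩
    exact add_mem (Submodule.smul_mem _ _ (hm 0)) (Submodule.smul_mem _ _ (hm 1))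

end Engel

/-! ### Calculus in an Engel frame -/

section EngelCalculus

variable [FiniteDimensional ℝ E] [I.Boundaryless]

omit [FiniteDimensional ℝ E] in
lemma OneForm.d_eq_neg_lie (ω : OneForm I M) {U V : VF I M} {a b : ℝ}
    (hU : ∀ x, ω.val x (U x) = a) (hV : ∀ x, ω.val x (V x) = b) (x : M) :
    ω.d U V x = -ω.val x (vfLie I U V x) := by
  simp only [OneForm.d, dOfFun, hU, hV, vderiv_const]
  ring

/-- The product of a smooth function and a one-form. -/
def OneForm.smulFn {f : M → ℝ} (hf : SmoothFn I f) (ω : OneForm I M) : OneForm I M where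
  val x := f x • ω.val x
  smooth' V hV := hf.mul (ω.smooth' V hV)

/-- The one-form `V ↦ ω(U, V)` obtained by inserting a vector field into `dω`. -/
def IsGlobalFrame.insertD {ι : Type*} [Fintype ι] [DecidableEq ι] {e : ι → VF I M}
    (h : IsGlobalFrame I e) (i₀ : ι) (ω : OneForm I M) {U : VF I M} (hU : SmoothVF I U) :
    OneForm I M where
  val x := ∑ i, ω.d U (e i) x • (h.coframe i).val x
  smooth' V hV := by
    simp only [LinearMap.sum_apply, LinearMap.smul_apply, smul_eq_mul]
    exact SmoothFn.sum _ fun i =>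
      (ω.smoothFn_d h i₀ hU (h.smooth i)).mul ((h.coframe i).smooth' V hV)

lemma IsGlobalFrame.insertD_apply {ι : Type*} [Fintype ι] [DecidableEq ι] {e : ι → VF I M}
    (h : IsGlobalFrame I e) (i₀ : ι) (ω : OneForm I M) {U V : VF I M} (hU : SmoothVF I U)
    (hV : SmoothVF I V) (x : M) : (h.insertD i₀ ω hU).val x (V x) = ω.d U V x := by
  rw [ω.d_eq_sum h U hV]
  simp [IsGlobalFrame.insertD, mul_comm]

variable {D : TangentDist I M} {W X Y Z : VF I M}

namespace IsEngelFrame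

section

variable (F : IsEngelFrame D W X Y Z)
include F

lemma smoothW : SmoothVF I W := F.frame.smooth 0
lemma smoothX : SmoothVF I X := F.frame.smooth 1
lemma smoothY : SmoothVF I Y := F.frame.smooth 2
lemma smoothZ : SmoothVF I Z := F.frame.smooth 3

/-- The coframe dual to an Engel frame. -/
abbrev θ (i : Fin 4) : OneForm I M := F.frame.coframe i

lemma θW (i : Fin 4) (x : M) : (F.θ i).val x (W x) = if 0 = i then 1 else 0 :=
  F.frame.coframe_frame i 0 x
lemma θX (i : Fin 4) (x : M) : (F.θ i).val x (X x) = if 1 = i then 1 else 0 :=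
  F.frame.coframe_frame i 1 x
lemma θY (i : Fin 4) (x : M) : (F.θ i).val x (Y x) = if 2 = i then 1 else 0 :=
  F.frame.coframe_frame i 2 x
lemma θZ (i : Fin 4) (x : M) : (F.θ i).val x (Z x) = if 3 = i then 1 else 0 :=
  F.frame.coframe_frame i 3 x

lemma expand (x : M) (v : TangentSpace I x) :
    v = (F.θ 0).val x v • W x + (F.θ 1).val x v • X x + (F.θ 2).val x v • Y x
      + (F.θ 3).val x v • Z x := by
  have := F.frame.sum_coframe x v
  rw [Fin.sum_univ_four] at this
  exact this.symm

lemma val_expand (ω : OneForm I M) (x : M) (v : TangentSpace I x) :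
    ω.val x v = (F.θ 0).val x v * ω.val x (W x) + (F.θ 1).val x v * ω.val x (X x)
      + (F.θ 2).val x v * ω.val x (Y x) + (F.θ 3).val x v * ω.val x (Z x) := by
  conv_lhs => rw [F.expand x v]
  simp only [map_add, map_smul, smul_eq_mul]

lemma d_expand (ω : OneForm I M) (U : VF I M) {V : VF I M} (hV : SmoothVF I V) (x : M) :
    ω.d U V x = (F.θ 0).val x (V x) * ω.d U W x + (F.θ 1).val x (V x) * ω.d U X x
      + (F.θ 2).val x (V x) * ω.d U Y x + (F.θ 3).val x (V x) * ω.d U Z x := by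
  rw [ω.d_eq_sum F.frame U hV, Fin.sum_univ_four]
  rfl

lemma W_mem (x : M) : W x ∈ D x := (F.mem_dist x _).2 ⟨F.θW 2 x, F.θW 3 x⟩

lemma X_mem (x : M) : X x ∈ D x := (F.mem_dist x _).2 ⟨F.θX 2 x, F.θX 3 x⟩

lemma mem_char (x : M) (v : TangentSpace I x) : v ∈ (ℝ ∙ (W x) : Submodule ℝ _) ↔
    (F.θ 1).val x v = 0 ∧ (F.θ 2).val x v = 0 ∧ (F.θ 3).val x v = 0 := by
  rw [Submodule.mem_span_singleton]
  constructor
  · rintro ⟨c, rfl⟩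
    simp [F.θW]
  · rintro ⟨h1, h2, h3⟩
    refine ⟨(F.θ 0).val x v, ?_⟩
    conv_rhs => rw [F.expand x v, h1, h2, h3]
    simp

lemma X_notMem_char (x : M) : X x ∉ (ℝ ∙ (W x) : Submodule ℝ _) := by
  rw [F.mem_char, F.θX]
  simp

end

/-! ### Defining forms -/

variable (F : IsEngelFrame D W X Y Z) {α β : OneForm I M}

section

variable (hα : ∀ x, derivedDist I D x = LinearMap.ker (α.val x))
include F hα

lemma αW (x : M) : α.val x (W x) = 0 := by
  rw [← LinearMap.mem_ker, ← hα, F.mem_derived]; exact F.θW 3 x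

lemma αX (x : M) : α.val x (X x) = 0 := by
  rw [← LinearMap.mem_ker, ← hα, F.mem_derived]; exact F.θX 3 x

lemma αY (x : M) : α.val x (Y x) = 0 := by
  rw [← LinearMap.mem_ker, ← hα, F.mem_derived]; exact F.θY 3 x

lemma αZ (x : M) : α.val x (Z x) ≠ 0 := by
  rw [ne_eq, ← LinearMap.mem_ker, ← hα, F.mem_derived, F.θZ]
  simp

lemma α_eq (x : M) (v : TangentSpace I x) :
    α.val x v = (F.θ 3).val x v * α.val x (Z x) := by
  rw [F.val_expand α x v, F.αW hα, F.αX hα, F.αY hα]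
  ring

lemma dα_WX (x : M) : α.d W X x = 0 := by
  rw [α.d_eq_neg_lie (F.αW hα) (F.αX hα), F.lieWX, F.αY hα, neg_zero]

lemma dα_WY (x : M) : α.d W Y x = 0 := by
  rw [α.d_eq_neg_lie (F.αW hα) (F.αY hα), F.α_eq hα, F.char, zero_mul, neg_zero]

lemma dα_XY (x : M) : α.d X Y x = -α.val x (Z x) := by
  rw [α.d_eq_neg_lie (F.αX hα) (F.αY hα), F.lieXY]

lemma dα_W (hP : ∀ x, α.d W Z x = 0) {V : VF I M} (hV : SmoothVF I V) (x : M) :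
    α.d W V x = 0 := by
  rw [F.d_expand α W hV, α.d_self, F.dα_WX hα, F.dα_WY hα, hP]
  ring

end

section

variable (hαβ : EngelDefiningForms I D α β)
include F hαβ

lemma βW (x : M) : β.val x (W x) = 0 := by
  have h := F.W_mem x
  rw [hαβ.1 x] at h
  exact h.2

lemma βX (x : M) : β.val x (X x) = 0 := by
  have h := F.X_mem x
  rw [hαβ.1 x] at h
  exact h.2

lemma βY (x : M) : β.val x (Y x) ≠ 0 := by
  intro h
  have h' : Y x ∈ D x := by
    rw [hαβ.1 x]
    exact ⟨F.αY hαβ.2 x, h⟩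
  rw [F.mem_dist, F.θY] at h'
  simp at h'

lemma β_eq (x : M) (v : TangentSpace I x) :
    β.val x v = (F.θ 2).val x v * β.val x (Y x) + (F.θ 3).val x v * β.val x (Z x) := by
  rw [F.val_expand β x v, F.βW hαβ, F.βX hαβ]
  ring

lemma dβ_WX (x : M) : β.d W X x = -β.val x (Y x) := by
  rw [β.d_eq_neg_lie (F.βW hαβ) (F.βX hαβ), F.lieWX]

/-- Every vector field can be modified by a section of `D` so as to become `dβ`-orthogonal to
`D`. -/
lemma exists_orthogonal {S : VF I M} (hS : SmoothVF I S) :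
    ∃ S' : VF I M, SmoothVF I S' ∧ (∀ x, α.val x (S' x) = α.val x (S x)) ∧
      (∀ x, β.val x (S' x) = β.val x (S x)) ∧ (∀ x, β.d S' W x = 0) ∧ ∀ x, β.d S' X x = 0 := by
  have := FiniteDimensional.complete ℝ E
  have hk := F.βY hαβ
  have hks := β.smooth' Y F.smoothY
  have ha : SmoothFn I (fun x => β.d W S x / β.val x (Y x)) :=
    (β.smoothFn_d F.frame 0 F.smoothW hS).div hks hk
  have hb : SmoothFn I (fun x => -(β.d X S x / β.val x (Y x))) :=
    ((β.smoothFn_d F.frame 0 F.smoothX hS).div hks hk).neg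
  have hX' := F.smoothX.smul ha
  have hW' := F.smoothW.smul hb
  refine ⟨S + ((fun x => β.d W S x / β.val x (Y x)) • X
    + (fun x => -(β.d X S x / β.val x (Y x))) • W), hS.add (hX'.add hW'), fun x => ?_, fun x => ?_,
    fun x => ?_, fun x => ?_⟩
  · simp [F.αX hαβ.2, F.αW hαβ.2]
  · simp [F.βX hαβ, F.βW hαβ]
  · rw [β.d_swap, β.d_add_right _ hS (hX'.add hW'), β.d_add_right _ hX' hW',
      β.d_smul_right _ ha F.smoothX, β.d_smul_right _ hb F.smoothW, β.d_self, F.dβ_WX hαβ]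
    field_simp [hk x]
    ring
  · rw [β.d_swap, β.d_add_right _ hS (hX'.add hW'), β.d_add_right _ hX' hW',
      β.d_smul_right _ ha F.smoothX, β.d_smul_right _ hb F.smoothW, β.d_self, β.d_swap X W,
      F.dβ_WX hαβ]
    field_simp [hk x]
    ring

lemma exists_isReebPair : ∃ T R, IsReebPair I α β T R := by
  have := FiniteDimensional.complete ℝ E
  have hh := F.αZ hαβ.2
  have hk := F.βY hαβ
  have hhs := α.smooth' Z F.smoothZ
  have hks := β.smooth' Y F.smoothY
  have hms := β.smooth' Z F.smoothZ
  obtain ⟨T, hT, hαT, hβT, hTW, hTX⟩ := F.exists_orthogonal hαβ (F.smoothY.smul (hks.inv hk))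
  have ha := hhs.inv hh
  have hb := ((hms.div hks hk).mul ha).neg
  obtain ⟨R, hR, hαR, hβR, hRW, hRX⟩ := F.exists_orthogonal hαβ
    ((F.smoothZ.smul ha).add (F.smoothY.smul hb))
  replace hαT : ∀ x, α.val x (T x) = 0 := fun x => by rw [hαT]; simp [F.αY hαβ.2]
  replace hβT : ∀ x, β.val x (T x) = 1 := fun x => by rw [hβT]; simp [hk x]
  replace hαR : ∀ x, α.val x (R x) = 1 := fun x => by rw [hαR]; simp [F.αY hαβ.2, hh x]
  replace hβR : ∀ x, β.val x (R x) = 0 := fun x => by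
    rw [hβR]; simp; field_simp [hk x]; ring
  refine ⟨T, R, hT, hR, hαT, hβT, hαR, hβR, fun V U hV hU x => ?_, fun V U hV hU x => ?_⟩
  · have h1 := F.d_expand β T hT x
    have h2 := hαT x
    have h3 := hβT x
    rw [F.α_eq hαβ.2, mul_eq_zero, or_iff_left (hh x)] at h2
    rw [F.β_eq hαβ, h2] at h3
    rw [β.d_self, hTW, hTX, h2] at h1
    have h4 : β.d T Y x = 0 := by linear_combination -(β.val x (Y x)) * h1 - β.d T Y x * h3
    simp only [wedge1_2, hαT]
    rw [F.d_expand β T hV, F.d_expand β T hU, hTW, hTX, h4, F.α_eq hαβ.2 x (V x),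
      F.α_eq hαβ.2 x (U x)]
    ring
  · have h1 := F.d_expand β R hR x
    have h2 := hαR x
    have h3 := hβR x
    rw [F.α_eq hαβ.2] at h2
    rw [F.β_eq hαβ] at h3
    rw [β.d_self, hRW, hRX] at h1
    have h4 : β.d R Z x * β.val x (Y x) = β.val x (Z x) * β.d R Y x := by
      linear_combination (-(α.val x (Z x)) * β.val x (Y x)) * h1
        - (α.val x (Z x) * β.d R Y x) * h3
        + (β.val x (Z x) * β.d R Y x - β.d R Z x * β.val x (Y x)) * h2
    simp only [wedge1_2, hβR]
    rw [F.d_expand β R hV, F.d_expand β R hU, hRW, hRX, F.β_eq hαβ x (V x),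
      F.β_eq hαβ x (U x)]
    linear_combination ((F.θ 2).val x (U x) * (F.θ 3).val x (V x)
      - (F.θ 2).val x (V x) * (F.θ 3).val x (U x)) * h4

end

end IsEngelFrame

end EngelCalculus

/-! ### Forms whose differential annihilates the characteristic foliation -/

section EngelForms

variable [FiniteDimensional ℝ E] [I.Boundaryless] {D : TangentDist I M} {W X Y Z : VF I M}
  {α β : OneForm I M}

lemma lieOneForm_eq_d {U : VF I M} (hU : ∀ x, α.val x (U x) = 0) (V : VF I M) (x : M) :
    lieOneForm I α U V x = α.d U V x := by
  simp only [lieOneForm, OneForm.d, dOfFun, hU, vderiv_const, sub_zero]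

namespace IsEngelFrame

variable (F : IsEngelFrame D W X Y Z)

section

variable (hα : ∀ x, derivedDist I D x = LinearMap.ker (α.val x))

/-- The form `-dα(X, ·) = -L_X α`. -/
def betaForm (α : OneForm I M) : OneForm I M :=
  OneForm.smulFn (SmoothFn.const (-1)) (F.frame.insertD 0 α F.smoothX)

lemma betaForm_apply (α : OneForm I M) {V : VF I M} (hV : SmoothVF I V) (x : M) :
    (F.betaForm α).val x (V x) = -α.d X V x := by
  rw [← F.frame.insertD_apply 0 α F.smoothX hV]
  simp [betaForm, OneForm.smulFn]

include hα

lemma engelDefiningForms_betaForm : EngelDefiningForms I D α (F.betaForm α) := by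
  refine ⟨fun x => ?_, hα⟩
  ext v
  rw [F.mem_dist, Submodule.mem_inf, LinearMap.mem_ker, LinearMap.mem_ker, F.α_eq hα,
    mul_eq_zero, or_iff_left (F.αZ hα x), F.val_expand (F.betaForm α) x v,
    F.betaForm_apply α F.smoothW, F.betaForm_apply α F.smoothX, F.betaForm_apply α F.smoothY,
    F.dα_XY hα, α.d_self, α.d_swap X W, F.dα_WX hα]
  have hh := F.αZ hα x
  constructor
  · rintro ⟨h2, h3⟩
    simp [h2, h3]
  · rintro ⟨h3, h2⟩
    refine ⟨?_, h3⟩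
    rw [h3] at h2
    simpa [hh] using h2

include F

lemma dα_WZ_of_formSqZero (hsq : FormSqZero I α.d) (x : M) : α.d W Z x = 0 := by
  have h := hsq W X Y Z F.smoothW F.smoothX F.smoothY F.smoothZ x
  rw [F.dα_WX hα, F.dα_WY hα, F.dα_XY hα] at h
  have hh := F.αZ hα x
  simpa [hh] using h

lemma dα_WZ_of_conformal (h : ∀ X X' : VF I M,
    SmoothVF I X → (∀ x, X x ∈ D x) → (∀ x, X x ∉ (ℝ ∙ (W x) : Submodule ℝ _)) →
    SmoothVF I X' → (∀ x, X' x ∈ D x) → (∀ x, X' x ∉ (ℝ ∙ (W x) : Submodule ℝ _)) →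
    ∃ f : M → ℝ, (∀ x, f x ≠ 0) ∧ ∀ V, SmoothVF I V → ∀ x,
      lieOneForm I α X' V x = f x * lieOneForm I α X V x) (x : M) : α.d W Z x = 0 := by
  have := FiniteDimensional.complete ℝ E
  obtain ⟨f, -, hf⟩ := h X (X + W) F.smoothX F.X_mem F.X_notMem_char
    (F.smoothX.add F.smoothW) (fun x => add_mem (F.X_mem x) (F.W_mem x)) (fun x => by
      rw [F.mem_char, Pi.add_apply, map_add, F.θX, F.θW]; simp)
  have key : ∀ V, SmoothVF I V → α.d X V x + α.d W V x = f x * α.d X V x := by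
    intro V hV
    have h1 := hf V hV x
    rw [lieOneForm_eq_d (F.αX hα), lieOneForm_eq_d (fun x => by simp [F.αX hα, F.αW hα]),
      α.d_swap (X + W), α.d_add_right V F.smoothX F.smoothW] at h1
    linear_combination h1 + α.d_swap V X x + α.d_swap V W x
  have hY := key Y F.smoothY
  have hZ := key Z F.smoothZ
  rw [F.dα_WY hα, F.dα_XY hα] at hY
  have hf1 : f x = 1 := by
    have : α.val x (Z x) * (f x - 1) = 0 := by linear_combination hY
    rcases mul_eq_zero.1 this with h | h
    · exact absurd h (F.αZ hα x)
    · linarith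
  rw [hf1] at hZ
  linarith

variable (hP : ∀ x, α.d W Z x = 0)
include hP

lemma dα_expand {U V : VF I M} (hU : SmoothVF I U) (hV : SmoothVF I V) (x : M) :
    α.d U V x =
      ((F.θ 1).val x (U x) * (F.θ 2).val x (V x) - (F.θ 2).val x (U x) * (F.θ 1).val x (V x))
        * α.d X Y x
      + ((F.θ 1).val x (U x) * (F.θ 3).val x (V x) - (F.θ 3).val x (U x) * (F.θ 1).val x (V x))
        * α.d X Z x
      + ((F.θ 2).val x (U x) * (F.θ 3).val x (V x) - (F.θ 3).val x (U x) * (F.θ 2).val x (V x))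
        * α.d Y Z x := by
  have hW : ∀ {V}, SmoothVF I V → α.d V W x = 0 := fun hV => by
    rw [α.d_swap, F.dα_W hα hP hV, neg_zero]
  rw [F.d_expand α U hV, hW hU, α.d_swap U X, α.d_swap U Y, α.d_swap U Z, F.d_expand α X hU,
    F.d_expand α Y hU, F.d_expand α Z hU, hW F.smoothX, hW F.smoothY, hW F.smoothZ,
    α.d_self, α.d_self, α.d_self, α.d_swap Y X, α.d_swap Z X, α.d_swap Z Y]
  ring

lemma wedge_betaForm {U V T : VF I M} (hU : SmoothVF I U) (hV : SmoothVF I V)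
    (hT : SmoothVF I T) (x : M) : wedge1_2 I (F.betaForm α) α.d U V T x = 0 := by
  simp only [wedge1_2, F.betaForm_apply α hU, F.betaForm_apply α hV, F.betaForm_apply α hT]
  rw [F.dα_expand hα hP F.smoothX hU, F.dα_expand hα hP F.smoothX hV,
    F.dα_expand hα hP F.smoothX hT, F.dα_expand hα hP hV hT, F.dα_expand hα hP hU hT,
    F.dα_expand hα hP hU hV]
  simp only [F.θX, if_true, Fin.reduceEq, if_false]
  ring

lemma exists_conformal {X₁ X₂ : VF I M} (hX₁ : SmoothVF I X₁) (hX₁D : ∀ x, X₁ x ∈ D x)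
    (hX₁W : ∀ x, X₁ x ∉ (ℝ ∙ (W x) : Submodule ℝ _)) (hX₂ : SmoothVF I X₂)
    (hX₂D : ∀ x, X₂ x ∈ D x) (hX₂W : ∀ x, X₂ x ∉ (ℝ ∙ (W x) : Submodule ℝ _)) :
    ∃ f : M → ℝ, (∀ x, f x ≠ 0) ∧ ∀ V, SmoothVF I V → ∀ x,
      lieOneForm I α X₂ V x = f x * lieOneForm I α X₁ V x := by
  have key : ∀ {U : VF I M}, SmoothVF I U → (∀ x, U x ∈ D x) →
      ∀ V, SmoothVF I V → ∀ x, lieOneForm I α U V x = (F.θ 1).val x (U x) * α.d X V x := by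
    intro U hU hUD V hV x
    have h := fun x => (F.mem_dist x _).1 (hUD x)
    rw [lieOneForm_eq_d (fun x => by rw [F.α_eq hα, (h x).2, zero_mul]), α.d_swap,
      F.d_expand α V hU, (h x).1, (h x).2, α.d_swap V W, F.dα_W hα hP hV, α.d_swap V X]
    ring
  have hne : ∀ {U : VF I M}, (∀ x, U x ∈ D x) →
      (∀ x, U x ∉ (ℝ ∙ (W x) : Submodule ℝ _)) → ∀ x, (F.θ 1).val x (U x) ≠ 0 := by
    intro U hUD hUW x h
    exact hUW x ((F.mem_char x _).2 ⟨h, (F.mem_dist x _).1 (hUD x)⟩)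
  refine ⟨fun x => (F.θ 1).val x (X₂ x) / (F.θ 1).val x (X₁ x),
    fun x => div_ne_zero (hne hX₂D hX₂W x) (hne hX₁D hX₁W x), fun V hV x => ?_⟩
  rw [key hX₁ hX₁D V hV, key hX₂ hX₂D V hV, ← mul_assoc,
    div_mul_cancel₀ _ (hne hX₁D hX₁W x)]

end

section

variable (hαβ : EngelDefiningForms I D α β)
include F hαβ

lemma dα_WZ_of_wedge (hw : ∀ U V T, SmoothVF I U → SmoothVF I V → SmoothVF I T → ∀ x,
    wedge1_2 I β α.d U V T x = 0) (x : M) : α.d W Z x = 0 := by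
  have h := hw W Y Z F.smoothW F.smoothY F.smoothZ x
  simp only [wedge1_2, F.βW hαβ, F.dα_WY hαβ.2] at h
  have hk := F.βY hαβ x
  simpa [hk] using h

variable {T R : VF I M} (hTR : IsReebPair I α β T R)
include hTR

lemma θ3R (x : M) : (F.θ 3).val x (R x) * α.val x (Z x) = 1 := by
  rw [← F.α_eq hαβ.2, hTR.alphaR]

lemma dα_WZ_of_reeb (hR : ∀ x, α.d R W x = 0) (x : M) : α.d W Z x = 0 := by
  have h := F.d_expand α W hTR.smoothR x
  rw [α.d_swap, hR, α.d_self, F.dα_WX hαβ.2, F.dα_WY hαβ.2] at h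
  linear_combination (-(α.val x (Z x))) * h - α.d W Z x * F.θ3R hαβ hTR x

lemma dα_WZ_of_preserves (h : ∀ V, IsSection I D V → ∀ x, vfLie I R V x ∈ D x) (x : M) :
    α.d W Z x = 0 := by
  refine F.dα_WZ_of_reeb hαβ hTR (fun x => ?_) x
  have h1 := h W ⟨F.smoothW, F.W_mem⟩ x
  rw [hαβ.1 x] at h1
  rw [α.d_eq_neg_lie hTR.alphaR (F.αW hαβ.2), LinearMap.mem_ker.1 h1.1, neg_zero]

lemma dβ_reeb {V : VF I M} (hV : IsSection I D V) (x : M) : β.d R V x = 0 := by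
  have h := hTR.insR V Y hV.1 F.smoothY x
  have h1 := hV.2 x
  rw [hαβ.1 x] at h1
  simp only [wedge1_2, hTR.betaR, LinearMap.mem_ker.1 h1.2] at h
  simpa [F.βY hαβ x] using h

variable (hw : ∀ U V T, SmoothVF I U → SmoothVF I V → SmoothVF I T → ∀ x,
    wedge1_2 I β α.d U V T x = 0)
include hw

lemma dα_reeb_of_section {V : VF I M} (hV : IsSection I D V) (x : M) : α.d R V x = 0 := by
  have h := hw R V Y hTR.smoothR hV.1 F.smoothY x
  have h1 := hV.2 x
  rw [hαβ.1 x] at h1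
  simp only [wedge1_2, hTR.betaR, LinearMap.mem_ker.1 h1.2] at h
  simpa [F.βY hαβ x] using h

lemma reeb_preserves {V : VF I M} (hV : IsSection I D V) (x : M) : vfLie I R V x ∈ D x := by
  have h1 : ∀ x, α.val x (V x) = 0 ∧ β.val x (V x) = 0 := by
    intro x
    have := hV.2 x
    rw [hαβ.1 x] at this
    exact this
  rw [hαβ.1 x]
  have h2 := F.dα_reeb_of_section hαβ hTR hw hV x
  have h3 := F.dβ_reeb hαβ hTR hV x
  rw [α.d_eq_neg_lie hTR.alphaR (fun x => (h1 x).1), neg_eq_zero] at h2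
  rw [β.d_eq_neg_lie hTR.betaR (fun x => (h1 x).2), neg_eq_zero] at h3
  exact ⟨h2, h3⟩

lemma dα_reeb_Y (x : M) : α.d R Y x = 0 := by
  have := FiniteDimensional.complete ℝ E
  have hP := F.dα_WZ_of_wedge hαβ hw
  have hWD : IsSection I D W := ⟨F.smoothW, F.W_mem⟩
  have hXD : IsSection I D X := ⟨F.smoothX, F.X_mem⟩
  have hh := F.αZ hαβ.2
  have hs : SmoothFn I (fun x => α.d R Y x / α.val x (Z x)) :=
    (α.smoothFn_d F.frame 0 hTR.smoothR F.smoothY).div (α.smooth' Z F.smoothZ) hh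
  set s := fun x => α.d R Y x / α.val x (Z x)
  have hsX := F.smoothX.smul hs
  have hS : SmoothVF I (R + s • X) := hTR.smoothR.add hsX
  set S := R + s • X with hSdef
  have hαS : ∀ x, α.val x (S x) = 1 := by
    intro x; simp [hSdef, hTR.alphaR, F.αX hαβ.2]
  have hβS : ∀ x, β.val x (S x) = 0 := by
    intro x; simp [hSdef, hTR.betaR, F.βX hαβ]
  have hdS : ∀ (ω : OneForm I M) (V : VF I M) (x : M),
      ω.d S V x = ω.d R V x + s x * ω.d X V x := by
    intro ω V x
    rw [ω.d_swap, hSdef, ω.d_add_right V hTR.smoothR hsX, ω.d_smul_right V hs F.smoothX,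
      ω.d_swap V R, ω.d_swap V X]
    ring
  have hSW : ∀ x, α.val x (vfLie I S W x) = 0 := by
    intro x
    have h1 := α.d_eq_neg_lie hαS (F.αW hαβ.2) x
    rw [hdS, F.dα_reeb_of_section hαβ hTR hw hWD, α.d_swap X W, F.dα_WX hαβ.2] at h1
    linarith
  have hSX : ∀ x, α.val x (vfLie I S X x) = 0 := by
    intro x
    have h1 := α.d_eq_neg_lie hαS (F.αX hαβ.2) x
    rw [hdS, F.dα_reeb_of_section hαβ hTR hw hXD, α.d_self] at h1
    linarith
  have hSY : ∀ x, α.val x (vfLie I S Y x) = 0 := by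
    intro x
    have h1 := α.d_eq_neg_lie hαS (F.αY hαβ.2) x
    have h2 : s x * α.val x (Z x) = α.d R Y x := div_mul_cancel₀ _ (hh x)
    rw [hdS, F.dα_XY hαβ.2] at h1
    linarith
  have hQ : SmoothVF I (vfLie I S W) := hS.vfLie F.smoothW
  have hN : SmoothVF I (vfLie I S X) := hS.vfLie F.smoothX
  have hθ3 : (F.θ 3).val x (vfLie I S W x) = 0 := by
    have h1 := hSW x
    rw [F.α_eq hαβ.2] at h1
    exact (mul_eq_zero.1 h1).resolve_right (hh x)
  have hθ2 : (F.θ 2).val x (vfLie I S W x) = 0 := by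
    have h1 := congrArg (α.val x) (vfLie_jacobi hS F.smoothW F.smoothX x)
    have h2 := α.d_eq_neg_lie (F.αW hαβ.2) hSX x
    rw [F.dα_W hαβ.2 hP hN] at h2
    rw [F.lieWX, map_add, hSY] at h1
    have h3 := α.d_eq_neg_lie hSW (F.αX hαβ.2) x
    rw [α.d_swap, F.d_expand α X hQ, hθ3, α.d_self, α.d_swap X W, F.dα_WX hαβ.2,
      F.dα_XY hαβ.2] at h3
    have h4 : (F.θ 2).val x (vfLie I S W x) * α.val x (Z x) = 0 := by linarith
    exact (mul_eq_zero.1 h4).resolve_right (hh x)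
  have h1 := β.d_eq_neg_lie hβS (F.βW hαβ) x
  rw [F.β_eq hαβ, hθ2, hθ3, hdS, F.dβ_reeb hαβ hTR hWD, β.d_swap X W, F.dβ_WX hαβ] at h1
  have h2 : s x * β.val x (Y x) = 0 := by linarith
  have h3 : α.d R Y x / α.val x (Z x) = 0 := (mul_eq_zero.1 h2).resolve_right (F.βY hαβ x)
  exact (div_eq_zero_iff.1 h3).resolve_right (hh x)

lemma dα_reeb {V : VF I M} (hV : SmoothVF I V) (x : M) : α.d R V x = 0 := by
  have h1 := F.dα_reeb_of_section hαβ hTR hw ⟨F.smoothW, F.W_mem⟩ x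
  have h2 := F.dα_reeb_of_section hαβ hTR hw ⟨F.smoothX, F.X_mem⟩ x
  have h3 := F.dα_reeb_Y hαβ hTR hw x
  have h4 := F.d_expand α R hTR.smoothR x
  rw [α.d_self, h1, h2, h3] at h4
  have h5 : α.d R Z x = 0 := by
    linear_combination (-(α.val x (Z x))) * h4 - α.d R Z x * F.θ3R hαβ hTR x
  rw [F.d_expand α R hV, h1, h2, h3, h5]
  ring

lemma ker_dα_iff {Θ : FormPt I M 2} (hΘ : ∀ V U, SmoothVF I V → SmoothVF I U → ∀ x,
    Θ.val x ![V x, U x] = α.d V U x) (x : M) (v : TangentSpace I x) :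
    (∀ u, Θ.val x ![v, u] = 0) ↔ v ∈ Submodule.span ℝ {W x, R x} := by
  have := FiniteDimensional.complete ℝ E
  have hP := F.dα_WZ_of_wedge hαβ hw
  constructor
  · intro hv
    obtain ⟨V, hV, rfl⟩ := F.frame.exists_smoothVF x v
    have hX := hv (X x)
    have hY := hv (Y x)
    rw [hΘ V _ hV F.smoothX, F.dα_expand hαβ.2 hP hV F.smoothX] at hX
    rw [hΘ V _ hV F.smoothY, F.dα_expand hαβ.2 hP hV F.smoothY] at hY
    have hRX := F.dα_reeb hαβ hTR hw F.smoothX x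
    have hRY := F.dα_reeb hαβ hTR hw F.smoothY x
    rw [F.dα_expand hαβ.2 hP hTR.smoothR F.smoothX] at hRX
    rw [F.dα_expand hαβ.2 hP hTR.smoothR F.smoothY] at hRY
    simp only [F.θX, F.θY, if_true, Fin.reduceEq, if_false, F.dα_XY hαβ.2] at hX hY hRX hRY
    have hθ := F.θ3R hαβ hTR x
    have hh := F.αZ hαβ.2 x
    have hmem : V x - α.val x (V x) • R x ∈ (ℝ ∙ (W x) : Submodule ℝ _) := by
      rw [F.mem_char]
      simp only [map_sub, map_smul, smul_eq_mul]
      rw [F.α_eq hαβ.2 x (V x)]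
      refine ⟨?_, ?_, ?_⟩
      · refine (mul_eq_zero.1 (?_ : _ * α.val x (Z x) = 0)).resolve_right hh
        linear_combination -hY + (F.θ 3).val x (V x) * α.val x (Z x) * hRY
          + (F.θ 3).val x (V x) * α.d Y Z x * hθ
      · refine (mul_eq_zero.1 (?_ : _ * α.val x (Z x) = 0)).resolve_right hh
        linear_combination hX - (F.θ 3).val x (V x) * α.val x (Z x) * hRX
          - (F.θ 3).val x (V x) * α.d X Z x * hθ
      · linear_combination -((F.θ 3).val x (V x)) * hθ
    rw [Submodule.mem_span_pair]
    obtain ⟨a, ha⟩ := Submodule.mem_span_singleton.1 hmem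
    exact ⟨a, α.val x (V x), by rw [ha]; abel⟩
  · intro hv u
    obtain ⟨a, b, rfl⟩ := Submodule.mem_span_pair.1 hv
    obtain ⟨U, hU, rfl⟩ := F.frame.exists_smoothVF x u
    have haW := F.smoothW.smul (SmoothFn.const a)
    have hbR := hTR.smoothR.smul (SmoothFn.const b)
    have h := hΘ _ U (haW.add hbR) hU x
    rw [α.d_swap, α.d_add_right U haW hbR, α.d_smul_right U (SmoothFn.const a) F.smoothW,
      α.d_smul_right U (SmoothFn.const b) hTR.smoothR, α.d_swap U W, F.dα_W hαβ.2 hP hU,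
      α.d_swap U R, F.dα_reeb hαβ hTR hw hU] at h
    simpa using h

end

end IsEngelFrame

end EngelForms

/-! ### Closed three-forms -/

section ThreeForm

/-- The value of a three-form on three vectors. -/
def FormPt.eval₃ (ν : FormPt I M (2 + 1)) (x : M) (u v w : TangentSpace I x) : ℝ :=
  ν.val x ![u, v, w]

namespace FormPt

variable (ν : FormPt I M (2 + 1))

lemma eval₃_add (x : M) (u u' v w : TangentSpace I x) :
    ν.eval₃ x (u + u') v w = ν.eval₃ x u v w + ν.eval₃ x u' v w :=
  (ν.val x).map_vecCons_add _ _ _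

lemma eval₃_smul (x : M) (c : ℝ) (u v w : TangentSpace I x) :
    ν.eval₃ x (c • u) v w = c * ν.eval₃ x u v w :=
  (ν.val x).map_vecCons_smul _ _ _

lemma eval₃_swap₀₁ (x : M) (u v w : TangentSpace I x) :
    ν.eval₃ x u v w = -ν.eval₃ x v u w := by
  have h := (ν.val x).map_swap ![v, u, w] (i := 0) (j := 1) (by decide)
  rw [eval₃, eval₃, ← h]
  congr 1
  ext i
  fin_cases i <;> rfl

lemma eval₃_swap₁₂ (x : M) (u v w : TangentSpace I x) :
    ν.eval₃ x u v w = -ν.eval₃ x u w v := by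
  have h := (ν.val x).map_swap ![u, w, v] (i := 1) (j := 2) (by decide)
  rw [eval₃, eval₃, ← h]
  congr 1
  ext i
  fin_cases i <;> rfl

lemma eval₃_neg (x : M) (u v w : TangentSpace I x) :
    ν.eval₃ x (-u) v w = -ν.eval₃ x u v w := by
  have := ν.eval₃_smul x (-1) u v w
  simpa using this

lemma eval₃_self₀₁ (x : M) (u w : TangentSpace I x) : ν.eval₃ x u u w = 0 := by
  have := ν.eval₃_swap₀₁ x u u w
  linarith

lemma eval₃_self₁₂ (x : M) (u w : TangentSpace I x) : ν.eval₃ x u w w = 0 := by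
  have := ν.eval₃_swap₁₂ x u w w
  linarith

lemma smoothFn_eval₃ {a b c : VF I M} (ha : SmoothVF I a) (hb : SmoothVF I b)
    (hc : SmoothVF I c) : SmoothFn I (fun x => ν.eval₃ x (a x) (b x) (c x)) := by
  convert ν.smooth' ![a, b, c] (by intro i; fin_cases i; exacts [ha, hb, hc]) using 2 with x
  rw [eval₃]
  congr 1
  ext i
  fin_cases i <;> rfl

/-- The exterior derivative of a three-form evaluated on four vector fields. -/
def d₄ (a b c d : VF I M) (x : M) : ℝ :=
  vderiv I a (fun y => ν.eval₃ y (b y) (c y) (d y)) x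
  - vderiv I b (fun y => ν.eval₃ y (a y) (c y) (d y)) x
  + vderiv I c (fun y => ν.eval₃ y (a y) (b y) (d y)) x
  - vderiv I d (fun y => ν.eval₃ y (a y) (b y) (c y)) x
  - ν.eval₃ x (vfLie I a b x) (c x) (d x) + ν.eval₃ x (vfLie I a c x) (b x) (d x)
  - ν.eval₃ x (vfLie I a d x) (b x) (c x) - ν.eval₃ x (vfLie I b c x) (a x) (d x)
  + ν.eval₃ x (vfLie I b d x) (a x) (c x) - ν.eval₃ x (vfLie I c d x) (a x) (b x)

lemma extDerEval_eq_d₄ (V : Fin 4 → VF I M) (x : M) :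
    extDerEval I ν V x = ν.d₄ (V 0) (V 1) (V 2) (V 3) x := by
  have hvec : ∀ {y : M} (u : Fin 3 → TangentSpace I y),
      ν.val y u = ν.eval₃ y (u 0) (u 1) (u 2) := by
    intro y u
    rw [eval₃]
    congr 1
    ext i
    fin_cases i <;> rfl
  have hsum : ∀ f : Fin (2 + 2) → ℝ, ∑ i, f i = f 0 + f 1 + f 2 + f 3 := Fin.sum_univ_four
  simp only [extDerEval, hvec, hsum, d₄]
  norm_num [Fin.cons]
  have hring : ∀ a₀ a₁ a₂ a₃ b₀ b₁ b₂ b₃ b₄ b₅ : ℝ,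
      a₀ + -a₁ + a₂ + -a₃ + (-b₀ + b₁ + -b₂ + (-b₃ + b₄) + -b₅)
        = a₀ - a₁ + a₂ - a₃ - b₀ + b₁ - b₂ - b₃ + b₄ - b₅ := by
    intros
    ring
  exact hring _ _ _ _ _ _ _ _ _ _

section

variable [I.Boundaryless]

lemma d₄_swap₀₁ (a b c d : VF I M) (x : M) : ν.d₄ a b c d x = -ν.d₄ b a c d x := by
  have h1 : (fun y => ν.eval₃ y (a y) (b y) (d y)) = fun y => -ν.eval₃ y (b y) (a y) (d y) :=
    funext fun y => ν.eval₃_swap₀₁ y _ _ _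
  have h2 : (fun y => ν.eval₃ y (a y) (b y) (c y)) = fun y => -ν.eval₃ y (b y) (a y) (c y) :=
    funext fun y => ν.eval₃_swap₀₁ y _ _ _
  simp only [d₄]
  rw [h1, h2, vderiv_neg, vderiv_neg, vfLie_swap a b, eval₃_neg,
    ν.eval₃_swap₁₂ x (vfLie I c d x) (a x)]
  ring

lemma d₄_swap₁₂ (a b c d : VF I M) (x : M) : ν.d₄ a b c d x = -ν.d₄ a c b d x := by
  have h1 : (fun y => ν.eval₃ y (b y) (c y) (d y)) = fun y => -ν.eval₃ y (c y) (b y) (d y) :=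
    funext fun y => ν.eval₃_swap₀₁ y _ _ _
  have h2 : (fun y => ν.eval₃ y (a y) (b y) (c y)) = fun y => -ν.eval₃ y (a y) (c y) (b y) :=
    funext fun y => ν.eval₃_swap₁₂ y _ _ _
  simp only [d₄]
  rw [h1, h2, vderiv_neg, vderiv_neg, vfLie_swap b c, eval₃_neg,
    ν.eval₃_swap₁₂ x (vfLie I a d x) (b x)]
  ring

lemma d₄_swap₂₃ (a b c d : VF I M) (x : M) : ν.d₄ a b c d x = -ν.d₄ a b d c x := by
  have h1 : (fun y => ν.eval₃ y (b y) (c y) (d y)) = fun y => -ν.eval₃ y (b y) (d y) (c y) :=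
    funext fun y => ν.eval₃_swap₁₂ y _ _ _
  have h2 : (fun y => ν.eval₃ y (a y) (c y) (d y)) = fun y => -ν.eval₃ y (a y) (d y) (c y) :=
    funext fun y => ν.eval₃_swap₁₂ y _ _ _
  simp only [d₄]
  rw [h1, h2, vderiv_neg, vderiv_neg, vfLie_swap c d, eval₃_neg,
    ν.eval₃_swap₁₂ x (vfLie I a b x) (c x)]
  ring

variable [CompleteSpace E]

lemma d₄_add {a a' b c d : VF I M} (ha : SmoothVF I a) (ha' : SmoothVF I a')
    (hb : SmoothVF I b) (hc : SmoothVF I c) (hd : SmoothVF I d) (x : M) :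
    ν.d₄ (a + a') b c d x = ν.d₄ a b c d x + ν.d₄ a' b c d x := by
  simp only [d₄, vderiv_add_field, Pi.add_apply, eval₃_add, vfLie_add_left _ ha ha']
  rw [vderiv_add b (ν.smoothFn_eval₃ ha hc hd) (ν.smoothFn_eval₃ ha' hc hd),
    vderiv_add c (ν.smoothFn_eval₃ ha hb hd) (ν.smoothFn_eval₃ ha' hb hd),
    vderiv_add d (ν.smoothFn_eval₃ ha hb hc) (ν.smoothFn_eval₃ ha' hb hc),
    ν.eval₃_swap₀₁ x (vfLie I b c x), ν.eval₃_swap₀₁ x (vfLie I b d x),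
    ν.eval₃_swap₀₁ x (vfLie I c d x)]
  simp only [eval₃_add]
  rw [ν.eval₃_swap₀₁ x (vfLie I b c x) (a x), ν.eval₃_swap₀₁ x (vfLie I b d x) (a x),
    ν.eval₃_swap₀₁ x (vfLie I c d x) (a x), ν.eval₃_swap₀₁ x (vfLie I b c x) (a' x),
    ν.eval₃_swap₀₁ x (vfLie I b d x) (a' x), ν.eval₃_swap₀₁ x (vfLie I c d x) (a' x)]
  ring

lemma d₄_smul {f : M → ℝ} {a b c d : VF I M} (hf : SmoothFn I f) (ha : SmoothVF I a)
    (hb : SmoothVF I b) (hc : SmoothVF I c) (hd : SmoothVF I d) (x : M) :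
    ν.d₄ (f • a) b c d x = f x * ν.d₄ a b c d x := by
  simp only [d₄, vderiv_smul_field, Pi.smul_apply', eval₃_smul, vfLie_smul_left _ hf ha]
  rw [vderiv_mul b hf (ν.smoothFn_eval₃ ha hc hd),
    vderiv_mul c hf (ν.smoothFn_eval₃ ha hb hd),
    vderiv_mul d hf (ν.smoothFn_eval₃ ha hb hc),
    ν.eval₃_swap₀₁ x (vfLie I b c x), ν.eval₃_swap₀₁ x (vfLie I b d x),
    ν.eval₃_swap₀₁ x (vfLie I c d x)]
  simp only [eval₃_add, eval₃_smul]
  rw [ν.eval₃_swap₀₁ x (vfLie I b c x) (a x), ν.eval₃_swap₀₁ x (vfLie I b d x) (a x),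
    ν.eval₃_swap₀₁ x (vfLie I c d x) (a x)]
  ring

lemma d₄_eq_zero [FiniteDimensional ℝ E] {e : Fin 4 → VF I M} (h : IsGlobalFrame I e) {x : M}
    (h₀ : ν.d₄ (e 0) (e 1) (e 2) (e 3) x = 0) {a b c d : VF I M} (ha : SmoothVF I a)
    (hb : SmoothVF I b) (hc : SmoothVF I c) (hd : SmoothVF I d) : ν.d₄ a b c d x = 0 := by
  let g : (Fin 4 → Fin 4) → ℝ := fun v => ν.d₄ (e (v 0)) (e (v 1)) (e (v 2)) (e (v 3)) x
  have hadj : ∀ (v : Fin 4 → Fin 4) (i : Fin 3),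
      g (v ∘ Equiv.swap i.castSucc i.succ) = -g v := by
    intro v i
    fin_cases i
    · exact ν.d₄_swap₀₁ _ _ _ _ x
    · exact ν.d₄_swap₁₂ _ _ _ _ x
    · exact ν.d₄_swap₂₃ _ _ _ _ x
  have hperm : ∀ (σ : Equiv.Perm (Fin 4)) (v : Fin 4 → Fin 4),
      g (v ∘ σ) = ((Equiv.Perm.sign σ : ℤ) : ℝ) * g v := by
    intro σ
    have hσ : σ ∈ Submonoid.closure
        (range fun i : Fin 3 => Equiv.swap i.castSucc i.succ) := by
      rw [Equiv.Perm.mclosure_swap_castSucc_succ]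
      trivial
    induction hσ using Submonoid.closure_induction with
    | mem τ hτ =>
      obtain ⟨i, rfl⟩ := hτ
      intro v
      have hne : i.castSucc ≠ i.succ := Fin.castSucc_lt_succ.ne
      simp [hadj, Equiv.Perm.sign_swap hne]
    | one => intro v; simp
    | mul τ ρ _ _ hτ hρ =>
      intro v
      rw [Equiv.Perm.coe_mul, ← comp_assoc, hρ, hτ, map_mul]
      push_cast
      ring
  have hg : ∀ v, g v = 0 := by
    intro v
    by_cases hv : Function.Injective v
    · have h1 := hperm (Equiv.ofBijective v (Finite.injective_iff_bijective.1 hv)) id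
      have h2 : g id = 0 := h₀
      rw [h2, mul_zero] at h1
      exact h1
    · obtain ⟨i, j, hij, hne⟩ : ∃ i j, v i = v j ∧ i ≠ j := by
        simpa [Function.Injective] using hv
      have h1 := hperm (Equiv.swap i j) v
      have h2 : v ∘ Equiv.swap i j = v := by
        ext1 k
        simp only [comp_apply, Equiv.swap_apply_def]
        split_ifs with h3 h4
        · rw [h3, hij]
        · rw [h4, hij]
        · rfl
      rw [h2, Equiv.Perm.sign_swap hne] at h1
      push_cast at h1
      linarith
  have hext : ∀ {b c d : VF I M}, SmoothVF I b → SmoothVF I c → SmoothVF I d →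
      (∀ i, ν.d₄ (e i) b c d x = 0) → ∀ {a}, SmoothVF I a → ν.d₄ a b c d x = 0 := by
    intro b c d hb hc hd hi a ha
    rw [h.tensorial_eq_sum (F := fun a => ν.d₄ a b c d x) (x := x)
      (fun _ _ h1 h2 => ν.d₄_add h1 h2 hb hc hd x)
      (fun _ _ h1 h2 => ν.d₄_smul h1 h2 hb hc hd x) ha]
    simp [hi]
  have hrot : ∀ a b c d : VF I M, ν.d₄ b c d a x = 0 → ν.d₄ a b c d x = 0 := by
    intro a b c d h1
    rw [ν.d₄_swap₀₁, ν.d₄_swap₁₂, ν.d₄_swap₂₃, h1]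
    simp
  have he := h.smooth
  have h1 : ∀ i j k, ν.d₄ d (e i) (e j) (e k) x = 0 := fun i j k =>
    hext (he i) (he j) (he k) (fun l => hg ![l, i, j, k]) hd
  have h2 : ∀ i j, ν.d₄ c d (e i) (e j) x = 0 := fun i j =>
    hext hd (he i) (he j) (fun k => hrot _ _ _ _ (h1 i j k)) hc
  have h3 : ∀ i, ν.d₄ b c d (e i) x = 0 := fun i =>
    hext hc hd (he i) (fun k => hrot _ _ _ _ (h2 i k)) hb
  exact hext hb hc hd (fun k => hrot _ _ _ _ (h3 k)) ha

end

end FormPt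

end ThreeForm

/-! ### Invariant transverse volumes -/

section Volume

variable [FiniteDimensional ℝ E]

omit [FiniteDimensional ℝ E] in
lemma AlternatingMap.sum_smul_apply {κ N : Type*} [Fintype κ] [AddCommGroup N] [Module ℝ N] {k : ℕ}
    (c : κ → ℝ) (f : κ → N [⋀^Fin k]→ₗ[ℝ] ℝ) (v : Fin k → N) :
    (∑ a, c a • f a) v = ∑ a, c a * f a v :=
  map_sum (⟨⟨fun g : N [⋀^Fin k]→ₗ[ℝ] ℝ => g v, rfl⟩, fun _ _ => rfl⟩ :
    (N [⋀^Fin k]→ₗ[ℝ] ℝ) →+ ℝ) _ _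

/-- A linear combination, with smooth coefficients, of exterior products of one-forms. -/
def FormPt.ofWedges {κ : Type*} [Fintype κ] {k : ℕ} {c : κ → M → ℝ}
    (hc : ∀ a, SmoothFn I (c a)) (ω : κ → Fin k → OneForm I M) : FormPt I M k where
  val x := ∑ a, c a x • Matrix.detRowAlternating.compLinearMap
    (LinearMap.pi fun i => (ω a i).val x)
  smooth' V hV := by
    simp only [AlternatingMap.sum_smul_apply]
    refine SmoothFn.sum _ fun a => (hc a).mul ?_
    change SmoothFn I (fun x => Matrix.det (Matrix.of fun i j => (ω a j).val x (V i x)))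
    simp only [Matrix.det_apply, Units.smul_def, zsmul_eq_mul]
    exact SmoothFn.sum _ fun σ => (SmoothFn.const _).mul
      (SmoothFn.prod _ fun i => (ω a i).smooth' _ (hV _))

omit [FiniteDimensional ℝ E] in
lemma FormPt.ofWedges_apply {κ : Type*} [Fintype κ] {k : ℕ} {c : κ → M → ℝ}
    (hc : ∀ a, SmoothFn I (c a)) (ω : κ → Fin k → OneForm I M) (x : M)
    (v : Fin k → TangentSpace I x) : (FormPt.ofWedges hc ω).val x v =
      ∑ a, c a x * Matrix.det (Matrix.of fun i j => (ω a j).val x (v i)) := by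
  simp only [FormPt.ofWedges, AlternatingMap.sum_smul_apply]
  rfl

variable [I.Boundaryless] {D : TangentDist I M} {W X Y Z : VF I M} {α : OneForm I M}

namespace IsEngelFrame

variable (F : IsEngelFrame D W X Y Z)
include F

/-- The differential of a form `α` with `dα(W, ·) = 0`, as a two-form. -/
lemma exists_twoForm (hα : ∀ x, derivedDist I D x = LinearMap.ker (α.val x))
    (hP : ∀ x, α.d W Z x = 0) : ∃ Θ : FormPt I M 2,
      ∀ V U, SmoothVF I V → SmoothVF I U → ∀ x, Θ.val x ![V x, U x] = α.d V U x := by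
  have hd : ∀ {V U : VF I M}, SmoothVF I V → SmoothVF I U → SmoothFn I (α.d V U) :=
    fun hV hU => α.smoothFn_d F.frame 0 hV hU
  have hc : ∀ a : Fin 3, SmoothFn I (![α.d X Y, α.d X Z, α.d Y Z] a) := by
    intro a
    fin_cases a
    exacts [hd F.smoothX F.smoothY, hd F.smoothX F.smoothZ, hd F.smoothY F.smoothZ]
  refine ⟨FormPt.ofWedges hc ![![F.θ 1, F.θ 2], ![F.θ 1, F.θ 3], ![F.θ 2, F.θ 3]],
    fun V U hV hU x => ?_⟩
  rw [FormPt.ofWedges_apply, F.dα_expand hα hP hV hU, Fin.sum_univ_three]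
  simp [Matrix.det_fin_two]
  ring

/-- The coefficients of `[W, Y]` along `Y` and of `[W, Z]` along `Z` agree. -/
lemma θ3_lieWZ (x : M) :
    (F.θ 3).val x (vfLie I W Z x) = (F.θ 2).val x (vfLie I W Y x) := by
  have := FiniteDimensional.complete ℝ E
  have hθ : ∀ x, derivedDist I D x = LinearMap.ker ((F.θ 3).val x) := by
    intro x
    ext v
    rw [F.mem_derived, LinearMap.mem_ker]
  have h1 := congrArg ((F.θ 3).val x) (vfLie_jacobi F.smoothW F.smoothX F.smoothY x)
  have hQ : SmoothVF I (vfLie I W Y) := F.smoothW.vfLie F.smoothY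
  have h2 := (F.θ 3).d_eq_neg_lie (F.αX hθ) F.char x
  rw [F.d_expand _ X hQ, F.char, OneForm.d_self, OneForm.d_swap _ X W, F.dα_WX hθ, F.dα_XY hθ,
    F.θZ] at h2
  rw [F.lieXY, F.lieWX, vfLie_self, zero_add] at h1
  rw [h1]
  simp only [if_true] at h2
  linarith

lemma eval₃_expand (ν : FormPt I M (2 + 1)) (x : M) (u v w : TangentSpace I x) :
    ν.eval₃ x u v w = (F.θ 0).val x u * ν.eval₃ x (W x) v w
      + (F.θ 1).val x u * ν.eval₃ x (X x) v w + (F.θ 2).val x u * ν.eval₃ x (Y x) v w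
      + (F.θ 3).val x u * ν.eval₃ x (Z x) v w := by
  conv_lhs => rw [F.expand x u]
  simp only [FormPt.eval₃_add, FormPt.eval₃_smul]

lemma d₄_frame {ν : FormPt I M (2 + 1)}
    (hν : ∀ x (v w : TangentSpace I x), ν.eval₃ x (W x) v w = 0) (x : M) :
    ν.d₄ W X Y Z x = vderiv I W (fun y => ν.eval₃ y (X y) (Y y) (Z y)) x
      - 2 * (F.θ 2).val x (vfLie I W Y x) * ν.eval₃ x (X x) (Y x) (Z x) := by
  have hν' : ∀ x (v w : TangentSpace I x), ν.eval₃ x v (W x) w = 0 := by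
    intro x v w
    rw [ν.eval₃_swap₀₁, hν, neg_zero]
  simp only [FormPt.d₄, hν, hν', vderiv_const, F.lieWX, ν.eval₃_self₀₁]
  rw [F.eval₃_expand ν x (vfLie I W Y x), F.eval₃_expand ν x (vfLie I W Z x), hν, hν,
    ν.eval₃_self₀₁, ν.eval₃_self₀₁, ν.eval₃_swap₀₁ x (Y x) (X x) (Y x), ν.eval₃_self₁₂,
    ν.eval₃_swap₁₂ x (Z x) (X x) (Z x), ν.eval₃_self₀₁, ν.eval₃_swap₀₁ x (Y x) (X x) (Z x),
    ν.eval₃_swap₀₁ x (Z x) (X x) (Y x), ν.eval₃_swap₁₂ x (X x) (Z x) (Y x), F.θ3_lieWZ]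
  ring

lemma exists_closed_of_dα_WZ (hα : ∀ x, derivedDist I D x = LinearMap.ker (α.val x))
    (hP : ∀ x, α.d W Z x = 0) : ∃ ν : FormPt I M (2 + 1), ν.IsClosedForm ∧
      ∀ x (v : TangentSpace I x),
        (∀ w : Fin 2 → TangentSpace I x, ν.val x (Fin.cons v w) = 0)
          ↔ v ∈ (ℝ ∙ (W x) : Submodule ℝ _) := by
  have := FiniteDimensional.complete ℝ E
  have hhs := α.smooth' Z F.smoothZ
  have hh := F.αZ hα
  let ν : FormPt I M (2 + 1) := FormPt.ofWedges
    (c := fun (_ : Unit) x => α.val x (Z x) * α.val x (Z x))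
    (fun _ => hhs.mul hhs) fun _ => ![F.θ 1, F.θ 2, F.θ 3]
  have hν : ∀ x (u v w : TangentSpace I x), ν.eval₃ x u v w =
      α.val x (Z x) * α.val x (Z x) *
        ((F.θ 1).val x u * ((F.θ 2).val x v * (F.θ 3).val x w - (F.θ 3).val x v * (F.θ 2).val x w)
        - (F.θ 2).val x u * ((F.θ 1).val x v * (F.θ 3).val x w - (F.θ 3).val x v * (F.θ 1).val x w)
        + (F.θ 3).val x u *
          ((F.θ 1).val x v * (F.θ 2).val x w - (F.θ 2).val x v * (F.θ 1).val x w)) := by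
    intro x u v w
    simp only [FormPt.eval₃, ν, FormPt.ofWedges_apply, Finset.univ_unique, Finset.sum_singleton]
    rw [Matrix.det_fin_three]
    simp [-mul_eq_mul_left_iff]
    ring
  have hker : ∀ x (v : TangentSpace I x), v ∈ (ℝ ∙ (W x) : Submodule ℝ _) →
      ∀ u w, ν.eval₃ x v u w = 0 := by
    intro x v hv u w
    rw [F.mem_char] at hv
    rw [hν, hv.1, hv.2.1, hv.2.2]
    ring
  refine ⟨ν, fun V hV x => ?_, fun x v => ⟨fun h => ?_, fun h w => ?_⟩⟩
  · rw [ν.extDerEval_eq_d₄]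
    refine ν.d₄_eq_zero F.frame ?_ (hV 0) (hV 1) (hV 2) (hV 3)
    refine (F.d₄_frame (fun x => hker x _ (Submodule.mem_span_singleton_self _)) x).trans ?_
    have h1 : (fun y => ν.eval₃ y (X y) (Y y) (Z y))
        = fun y => α.val y (Z y) * α.val y (Z y) := by
      ext y
      simp [hν, F.θX, F.θY, F.θZ]
    have h2 : α.d W Z x = vderiv I W (fun y => α.val y (Z y)) x
        - α.val x (Z x) * (F.θ 2).val x (vfLie I W Y x) := by
      simp only [OneForm.d, dOfFun, F.αW hα, vderiv_const]
      rw [F.α_eq hα x (vfLie I W Z x), F.θ3_lieWZ]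
      ring
    rw [hP] at h2
    have h3 := congrFun h1 x
    rw [h1, vderiv_mul W hhs hhs, h3]
    linear_combination (-2 * α.val x (Z x)) * h2
  · rw [F.mem_char]
    have hXY : ν.eval₃ x v (X x) (Y x) = 0 := h ![X x, Y x]
    have hXZ : ν.eval₃ x v (X x) (Z x) = 0 := h ![X x, Z x]
    have hYZ : ν.eval₃ x v (Y x) (Z x) = 0 := h ![Y x, Z x]
    simp [hν, F.θX, F.θY, F.θZ, hh x] at hXY hXZ hYZ
    exact ⟨hYZ, hXZ, hXY⟩
  · have : (Fin.cons v w : Fin 3 → TangentSpace I x) = ![v, w 0, w 1] := by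
      ext i
      fin_cases i <;> rfl
    exact (congrArg (ν.val x) this).trans (hker x v h _ _)

lemma exists_dα_WZ_of_closed {ν : FormPt I M (2 + 1)} (hcl : ν.IsClosedForm)
    (hker : ∀ x (v : TangentSpace I x),
      (∀ w : Fin 2 → TangentSpace I x, ν.val x (Fin.cons v w) = 0)
        ↔ v ∈ (ℝ ∙ (W x) : Submodule ℝ _)) :
    ∃ α : OneForm I M, (∀ x, derivedDist I D x = LinearMap.ker (α.val x)) ∧
      ∀ x, α.d W Z x = 0 := by
  have := FiniteDimensional.complete ℝ E
  have hW : ∀ x (v w : TangentSpace I x), ν.eval₃ x (W x) v w = 0 := fun x v w =>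
    (hker x (W x)).2 (Submodule.mem_span_singleton_self _) ![v, w]
  let n : M → ℝ := fun x => ν.eval₃ x (X x) (Y x) (Z x)
  have hns : SmoothFn I n := ν.smoothFn_eval₃ F.smoothX F.smoothY F.smoothZ
  have hn : ∀ x, n x ≠ 0 := by
    intro x hx
    have hXYZ : ν.eval₃ x (X x) (Y x) (Z x) = 0 := hx
    refine F.X_notMem_char x ((hker x (X x)).1 fun w => ?_)
    have h1 : ∀ a b, ν.eval₃ x (X x) a b = 0 := by
      intro a b
      have hb : ν.eval₃ x (Y x) (X x) b = 0 := by
        rw [ν.eval₃_swap₁₂, ν.eval₃_swap₀₁, F.eval₃_expand ν x b, hW, ν.eval₃_self₀₁,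
          ν.eval₃_swap₁₂ x (X x), ν.eval₃_self₀₁, ν.eval₃_swap₁₂ x (Z x), ν.eval₃_swap₀₁ x (Z x),
          ν.eval₃_swap₁₂ x (X x), hXYZ]
        simp
      have hb' : ν.eval₃ x (Z x) (X x) b = 0 := by
        rw [ν.eval₃_swap₁₂, ν.eval₃_swap₀₁, F.eval₃_expand ν x b, hW, ν.eval₃_self₀₁,
          ν.eval₃_swap₁₂ x (X x), ν.eval₃_self₀₁, ν.eval₃_swap₁₂ x (Y x), ν.eval₃_swap₀₁ x (Y x),
          hXYZ]
        simp
      rw [ν.eval₃_swap₀₁, F.eval₃_expand ν x a, hW, ν.eval₃_self₀₁, hb, hb']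
      ring
    have h2 : (Fin.cons (X x) w : Fin 3 → TangentSpace I x) = ![X x, w 0, w 1] := by
      ext i
      fin_cases i <;> rfl
    exact (congrArg (ν.val x) h2).trans (h1 _ _)
  have hWn : ∀ x, vderiv I W n x = 2 * (F.θ 2).val x (vfLie I W Y x) * n x := by
    intro x
    have h1 := hcl ![W, X, Y, Z] F.frame.smooth x
    rw [ν.extDerEval_eq_d₄] at h1
    have h2 := (F.d₄_frame hW x).symm.trans h1
    linarith
  have hsq : ∀ x, n x * n x ≠ 0 := fun x => mul_self_ne_zero.2 (hn x)
  have hsqrt : ∀ x, √(n x * n x) ≠ 0 := fun x =>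
    (Real.sqrt_pos.2 (mul_self_pos.2 (hn x))).ne'
  let h : M → ℝ := fun x => √√(n x * n x)
  have hs : SmoothFn I h := ((hns.mul hns).sqrt hsq).sqrt hsqrt
  have hpos : ∀ x, 0 < h x := fun x =>
    Real.sqrt_pos.2 (Real.sqrt_pos.2 (mul_self_pos.2 (hn x)))
  have h4 : ∀ x, (h x * h x) * (h x * h x) = n x * n x := fun x => by
    rw [Real.mul_self_sqrt (Real.sqrt_nonneg _), Real.mul_self_sqrt (mul_self_nonneg _)]
  have hWh : ∀ x, vderiv I W h x = h x * (F.θ 2).val x (vfLie I W Y x) := by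
    intro x
    have h5 : vderiv I W (fun x => (h x * h x) * (h x * h x)) x
        = vderiv I W (fun x => n x * n x) x := by rw [funext h4]
    rw [vderiv_mul W (hs.mul hs) (hs.mul hs), vderiv_mul W hs hs, vderiv_mul W hns hns, hWn] at h5
    have h6 : 4 * (h x * h x * h x) *
        (vderiv I W h x - h x * (F.θ 2).val x (vfLie I W Y x)) = 0 := by
      linear_combination h5 - 4 * (F.θ 2).val x (vfLie I W Y x) * h4 x
    have h7 : 4 * (h x * h x * h x) ≠ 0 := by
      have := hpos x
      positivity
    linarith [(mul_eq_zero.1 h6).resolve_left h7]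
  refine ⟨OneForm.smulFn hs (F.θ 3), fun x => ?_, fun x => ?_⟩
  · ext v
    rw [F.mem_derived, LinearMap.mem_ker]
    simp [OneForm.smulFn, (hpos x).ne']
  · simp only [OneForm.d, dOfFun, OneForm.smulFn, LinearMap.smul_apply, smul_eq_mul, F.θW, F.θZ,
      F.θ3_lieWZ]
    simp [vderiv_const, hWh]

end IsEngelFrame

end Volume

/-- For an Engel structure `(M, D)` with `D` trivial as a bundle and `M`
orientable, the following are equivalent: (1) the characteristic foliation `𝒲` is volume
preserving (equivalently, it is the kernel of a closed 3-form); (2) there are defining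
forms with `L_R D ⊆ D`; (3) there are defining forms with `ker dα = ⟨W, R⟩`; (4) there
are defining forms with `β ∧ dα = 0`; (5) there is `α` such that the conformal class of
`β = L_X α` does not depend on the choice of `X ∈ Γ(D)` transverse to `𝒲`.  Moreover if
`dα ∧ dα = 0` there is a choice `β = −L_X α` realizing the above properties
simultaneously. -/
theorem volume_preserving_characteristic_foliation_tfae {M : Type*} [TopologicalSpace M]
    [ChartedSpace (EuclideanSpace ℝ (Fin 4)) M] [IsManifold (𝓡 4) (⊤ : ℕ∞) M]
    (D : TangentDist (𝓡 4) M) (hD : IsEngel (𝓡 4) D)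
    -- `D` is trivial as a bundle (hence orientable), framed by `W₀, X₀` with `W₀`
    -- spanning the characteristic foliation
    (W₀ X₀ : VF (𝓡 4) M) (hW₀ : SpansChar (𝓡 4) D W₀) (hX₀ : SmoothVF (𝓡 4) X₀)
    (hspan : ∀ x, D x = Submodule.span ℝ {W₀ x, X₀ x})
    (hX₀W₀ : ∀ x, X₀ x ∉ (ℝ ∙ (W₀ x) : Submodule ℝ _))
    -- `M` is orientable
    (hor : ∃ vol : FormPt (𝓡 4) M 4, ∀ x, vol.val x ≠ 0) :
    -- (1) ↔ (2)
    (((∃ ν : FormPt (𝓡 4) M (2+1), ν.IsClosedForm ∧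
        ∀ x (v : TangentSpace (𝓡 4) x),
          ((∀ w : Fin 2 → TangentSpace (𝓡 4) x, ν.val x (Fin.cons v w) = 0)
            ↔ v ∈ (ℝ ∙ (W₀ x) : Submodule ℝ _)))) ↔
      (∃ (α β : OneForm (𝓡 4) M) (T R : VF (𝓡 4) M),
        EngelDefiningForms (𝓡 4) D α β ∧ IsReebPair (𝓡 4) α β T R ∧
        ∀ V, IsSection (𝓡 4) D V → ∀ x, vfLie (𝓡 4) R V x ∈ D x)) ∧
    -- (2) ↔ (3)
    ((∃ (α β : OneForm (𝓡 4) M) (T R : VF (𝓡 4) M),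
        EngelDefiningForms (𝓡 4) D α β ∧ IsReebPair (𝓡 4) α β T R ∧
        ∀ V, IsSection (𝓡 4) D V → ∀ x, vfLie (𝓡 4) R V x ∈ D x) ↔
      (∃ (α β : OneForm (𝓡 4) M) (T R : VF (𝓡 4) M) (Θ : FormPt (𝓡 4) M 2),
        EngelDefiningForms (𝓡 4) D α β ∧ IsReebPair (𝓡 4) α β T R ∧
        (∀ V W, SmoothVF (𝓡 4) V → SmoothVF (𝓡 4) W → ∀ x,
          Θ.val x ![V x, W x] = α.d V W x) ∧
        ∀ x (v : TangentSpace (𝓡 4) x),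
          ((∀ u, Θ.val x ![v, u] = 0) ↔ v ∈ Submodule.span ℝ {W₀ x, R x}))) ∧
    -- (3) ↔ (4)
    ((∃ (α β : OneForm (𝓡 4) M) (T R : VF (𝓡 4) M) (Θ : FormPt (𝓡 4) M 2),
        EngelDefiningForms (𝓡 4) D α β ∧ IsReebPair (𝓡 4) α β T R ∧
        (∀ V W, SmoothVF (𝓡 4) V → SmoothVF (𝓡 4) W → ∀ x,
          Θ.val x ![V x, W x] = α.d V W x) ∧
        ∀ x (v : TangentSpace (𝓡 4) x),
          ((∀ u, Θ.val x ![v, u] = 0) ↔ v ∈ Submodule.span ℝ {W₀ x, R x})) ↔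
      (∃ α β : OneForm (𝓡 4) M, EngelDefiningForms (𝓡 4) D α β ∧
        ∀ U V W, SmoothVF (𝓡 4) U → SmoothVF (𝓡 4) V → SmoothVF (𝓡 4) W → ∀ x,
          wedge1_2 (𝓡 4) β α.d U V W x = 0)) ∧
    -- (4) ↔ (5)
    ((∃ α β : OneForm (𝓡 4) M, EngelDefiningForms (𝓡 4) D α β ∧
        ∀ U V W, SmoothVF (𝓡 4) U → SmoothVF (𝓡 4) V → SmoothVF (𝓡 4) W → ∀ x,
          wedge1_2 (𝓡 4) β α.d U V W x = 0) ↔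
      (∃ α : OneForm (𝓡 4) M, (∀ x, derivedDist (𝓡 4) D x = LinearMap.ker (α.val x)) ∧
        ∀ X X' : VF (𝓡 4) M,
          SmoothVF (𝓡 4) X → (∀ x, X x ∈ D x) →
            (∀ x, X x ∉ (ℝ ∙ (W₀ x) : Submodule ℝ _)) →
          SmoothVF (𝓡 4) X' → (∀ x, X' x ∈ D x) →
            (∀ x, X' x ∉ (ℝ ∙ (W₀ x) : Submodule ℝ _)) →
          ∃ f : M → ℝ, (∀ x, f x ≠ 0) ∧
            ∀ V, SmoothVF (𝓡 4) V → ∀ x,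
              lieOneForm (𝓡 4) α X' V x = f x * lieOneForm (𝓡 4) α X V x)) ∧
    -- Moreover: if `dα ∧ dα = 0` then a single choice `β = -L_X α` realizes all of them
    (∀ α : OneForm (𝓡 4) M, (∀ x, derivedDist (𝓡 4) D x = LinearMap.ker (α.val x)) →
      FormSqZero (𝓡 4) α.d →
      ∃ (X : VF (𝓡 4) M) (β : OneForm (𝓡 4) M),
        SmoothVF (𝓡 4) X ∧ (∀ x, X x ∈ D x) ∧
        (∀ x, X x ∉ (ℝ ∙ (W₀ x) : Submodule ℝ _)) ∧
        -- `β = -L_X α`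
        (∀ V, SmoothVF (𝓡 4) V → ∀ x,
          β.val x (V x) = -(lieOneForm (𝓡 4) α X V x)) ∧
        EngelDefiningForms (𝓡 4) D α β ∧
        (∃ T R : VF (𝓡 4) M, IsReebPair (𝓡 4) α β T R ∧
          ∀ V, IsSection (𝓡 4) D V → ∀ x, vfLie (𝓡 4) R V x ∈ D x) ∧
        (∀ U V W, SmoothVF (𝓡 4) U → SmoothVF (𝓡 4) V → SmoothVF (𝓡 4) W → ∀ x,
          wedge1_2 (𝓡 4) β α.d U V W x = 0)) := by
  have F := isEngelFrame_of_isEngel (by simp) hD hW₀ hX₀ hspan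
  set Z₀ := vfLie (𝓡 4) X₀ (vfLie (𝓡 4) W₀ X₀)
  let P : Prop := ∃ α : OneForm (𝓡 4) M,
    (∀ x, derivedDist (𝓡 4) D x = LinearMap.ker (α.val x)) ∧ ∀ x, α.d W₀ Z₀ x = 0
  have hvol : _ ↔ P := ⟨fun ⟨_, hcl, hker⟩ => F.exists_dα_WZ_of_closed hcl hker,
    fun ⟨_, hα, hP⟩ => F.exists_closed_of_dα_WZ hα hP⟩
  have hreeb : (∃ (α β : OneForm (𝓡 4) M) (T R : VF (𝓡 4) M),
      EngelDefiningForms (𝓡 4) D α β ∧ IsReebPair (𝓡 4) α β T R ∧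
      ∀ V, IsSection (𝓡 4) D V → ∀ x, vfLie (𝓡 4) R V x ∈ D x) ↔ P := by
    constructor
    · rintro ⟨α, β, T, R, hαβ, hTR, h⟩
      exact ⟨α, hαβ.2, F.dα_WZ_of_preserves hαβ hTR h⟩
    · rintro ⟨α, hα, hP⟩
      have hαβ := F.engelDefiningForms_betaForm hα
      obtain ⟨T, R, hTR⟩ := F.exists_isReebPair hαβ
      exact ⟨α, _, T, R, hαβ, hTR, fun _ hV => F.reeb_preserves hαβ hTR
        (fun _ _ _ hU hV hT => F.wedge_betaForm hα hP hU hV hT) hV⟩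
  have hker : (∃ (α β : OneForm (𝓡 4) M) (T R : VF (𝓡 4) M) (Θ : FormPt (𝓡 4) M 2),
      EngelDefiningForms (𝓡 4) D α β ∧ IsReebPair (𝓡 4) α β T R ∧
      (∀ V W, SmoothVF (𝓡 4) V → SmoothVF (𝓡 4) W → ∀ x,
        Θ.val x ![V x, W x] = α.d V W x) ∧
      ∀ x (v : TangentSpace (𝓡 4) x),
        ((∀ u, Θ.val x ![v, u] = 0) ↔ v ∈ Submodule.span ℝ {W₀ x, R x})) ↔ P := by
    constructor
    · rintro ⟨α, β, T, R, Θ, hαβ, hTR, hΘ, h⟩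
      refine ⟨α, hαβ.2, fun x => ?_⟩
      rw [← hΘ _ _ F.smoothW F.smoothZ]
      exact (h x (W₀ x)).2 (Submodule.subset_span (Set.mem_insert _ _)) _
    · rintro ⟨α, hα, hP⟩
      have hαβ := F.engelDefiningForms_betaForm hα
      obtain ⟨T, R, hTR⟩ := F.exists_isReebPair hαβ
      obtain ⟨Θ, hΘ⟩ := F.exists_twoForm hα hP
      exact ⟨α, _, T, R, Θ, hαβ, hTR, hΘ, F.ker_dα_iff hαβ hTR
        (fun _ _ _ hU hV hT => F.wedge_betaForm hα hP hU hV hT) hΘ⟩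
  have hwedge : (∃ α β : OneForm (𝓡 4) M, EngelDefiningForms (𝓡 4) D α β ∧
      ∀ U V W, SmoothVF (𝓡 4) U → SmoothVF (𝓡 4) V → SmoothVF (𝓡 4) W → ∀ x,
        wedge1_2 (𝓡 4) β α.d U V W x = 0) ↔ P :=
    ⟨fun ⟨α, _, hαβ, h⟩ => ⟨α, hαβ.2, F.dα_WZ_of_wedge hαβ h⟩,
      fun ⟨α, hα, hP⟩ => ⟨α, _, F.engelDefiningForms_betaForm hα,
        fun _ _ _ hU hV hT => F.wedge_betaForm hα hP hU hV hT⟩⟩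
  refine ⟨hvol.trans hreeb.symm, hreeb.trans hker.symm, hker.trans hwedge.symm,
    hwedge.trans ⟨fun ⟨α, hα, hP⟩ => ⟨α, hα, fun _ _ h₁ h₂ h₃ h₄ h₅ h₆ =>
      F.exists_conformal hα hP h₁ h₂ h₃ h₄ h₅ h₆⟩,
      fun ⟨α, hα, h⟩ => ⟨α, hα, F.dα_WZ_of_conformal hα h⟩⟩, fun α hα hsq => ?_⟩
  have hP := F.dα_WZ_of_formSqZero hα hsq
  have hαβ := F.engelDefiningForms_betaForm hα
  have hw : ∀ U V W, SmoothVF (𝓡 4) U → SmoothVF (𝓡 4) V → SmoothVF (𝓡 4) W → ∀ x,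
      wedge1_2 (𝓡 4) (F.betaForm α) α.d U V W x = 0 :=
    fun _ _ _ hU hV hT => F.wedge_betaForm hα hP hU hV hT
  obtain ⟨T, R, hTR⟩ := F.exists_isReebPair hαβ
  refine ⟨X₀, F.betaForm α, hX₀, F.X_mem, hX₀W₀, fun V hV x => ?_, hαβ,
    ⟨T, R, hTR, fun _ hV => F.reeb_preserves hαβ hTR hw hV⟩, hw⟩
  rw [F.betaForm_apply α hV, lieOneForm_eq_d (F.αX hα)]

end
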